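/- Let R' = F_q[Q_{n,0}, Q_{n,1}, …, Q_{n,n−1}] ⊆ S(V). Then (S(V)⊗Λ(V))^{GL_n(q)} = R' ⊕ ⨁_{j=1}^{n} ⨁_{0 ≤ b_1 < ⋯ < b_j ≤ n−1} M_{n;b_1,…,b_j} L_n^{q−2} · R', a direct sum of R'-submodules; equivalently, (S(V)⊗Λ(V))^{GL_n(q)} is a free R'-module with basis consisting of 1 together with the elements M_{n;b_1,…,b_j}·L_n^{q−2} for 1 ≤ j ≤ n and 0 ≤ b_1 < ⋯ < b_j ≤ n−1. In particular S(V)^{GL_n(q)} = F_q[Q_{n,0}, Q_{n,1}, …, Q_{n,n−1}]. -/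

import Mathlib

open scoped TensorProduct
open MvPolynomial Finset

noncomputable section

/-- The symmetric algebra `S(V) = F[x_1,…,x_n]` of the natural module `V = F^n`. -/
abbrev SV (F : Type) [Field F] (n : ℕ) := MvPolynomial (Fin n) F

/-- The exterior algebra `Λ(V) = E[y_1,…,y_n]`. -/
abbrev LV (F : Type) [Field F] (n : ℕ) := ExteriorAlgebra F (Fin n → F)

/-- `S(V) ⊗ Λ(V)`. -/
abbrev SL (F : Type) [Field F] (n : ℕ) := SV F n ⊗[F] LV F n

/-- the variable `x_{a+1}` (0-indexed `a`), junk value `0` out of range. -/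
def xV (F : Type) [Field F] (n a : ℕ) : SV F n :=
  if h : a < n then X ⟨a, h⟩ else 0

/-- the exterior generator `y_{a+1}` (0-indexed `a`). -/
def yV (F : Type) [Field F] (n a : ℕ) : LV F n :=
  if h : a < n then ExteriorAlgebra.ι F (Pi.single (⟨a, h⟩ : Fin n) (1 : F)) else 0

/-- the product `y_{s_1} ⋯ y_{s_j}` over `S = {s_1 < ⋯ < s_j}` in increasing order. -/
def yProd (F : Type) [Field F] (n : ℕ) (S : Finset ℕ) : LV F n :=
  ((S.sort (· ≤ ·)).map (yV F n)).prod

/-- determinant of the matrix `(x_t^{q^c})` with rows indexed by `c ∈ R` in increasing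
order and columns by `t ∈ C` in increasing order; junk value `0` if sizes differ. -/
def subDet (F : Type) [Field F] (q n : ℕ) (R C : Finset ℕ) : SV F n :=
  if h : C.card = R.card then
    Matrix.det (Matrix.of fun i j : Fin R.card =>
      xV F n (C.orderEmbOfFin h j) ^ q ^ (R.orderEmbOfFin rfl i : ℕ))
  else 0

/-- Mui's element `M_{m;b_1,…,b_j}` where `B = {b_1 < ⋯ < b_j}` (0-indexed `b`'s);
for `B = ∅` this is the Moore determinant `det (x_t^{q^c})`. -/
def MuiM (F : Type) [Field F] (q n m : ℕ) (B : Finset ℕ) : SL F n :=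
  ∑ S ∈ (range m).powersetCard B.card,
    ((-1 : F) ^ (B.card * (B.card + 1) / 2 + (∑ s ∈ S, s) + B.card)) •
      (subDet F q n (range m \ B) (range m \ S) ⊗ₜ[F] yProd F n S)

/-- `∏_{c : F^a} (c_1 x_1 + ⋯ + c_a x_a + x_{t+1})` (0-indexed `t`). -/
def linProd (F : Type) [Field F] [Fintype F] (n a t : ℕ) : SV F n :=
  ∏ c : Fin a → F, ((∑ k : Fin a, MvPolynomial.C (c k) * xV F n k) + xV F n t)

/-- Dickson's `L_m = V_1 V_2 ⋯ V_m`. -/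
def Lm (F : Type) [Field F] [Fintype F] (n m : ℕ) : SV F n :=
  ∏ a ∈ range m, linProd F n a a

/-- The property characterizing the Dickson invariants `Q_{m,k}`:
`Q_{m,k} · L_m = L_{m,k}` in `F[x_1,…,x_m]`. -/
def DicksonProp (F : Type) [Field F] [Fintype F] (q : ℕ)
    (Q : (m : ℕ) → ℕ → SV F m) : Prop :=
  ∀ m k : ℕ, k ≤ m →
    Q m k * Lm F m m = subDet F q m (range (m + 1) \ {k}) (range m)

/-- action of a matrix on `S(V)` by linear substitution: `x_j ↦ ∑_i g_{ij} x_i`. -/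
def gAct (F : Type) [Field F] (n : ℕ) (g : Matrix (Fin n) (Fin n) F) :
    SV F n →ₐ[F] SV F n :=
  MvPolynomial.aeval fun j => ∑ i, MvPolynomial.C (g i j) * MvPolynomial.X i

/-- action of a matrix on `Λ(V)` by linear substitution: `y_j ↦ ∑_i g_{ij} y_i`. -/
def eAct (F : Type) [Field F] (n : ℕ) (g : Matrix (Fin n) (Fin n) F) :
    LV F n →ₐ[F] LV F n :=
  ExteriorAlgebra.map g.mulVecLin

/-- diagonal action of a matrix on `S(V) ⊗ Λ(V)`. -/
def tAct (F : Type) [Field F] (n : ℕ) (g : Matrix (Fin n) (Fin n) F) :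
    SL F n →ₐ[F] SL F n :=
  Algebra.TensorProduct.map (gAct F n g) (eAct F n g)

/-- the invariants of a set of matrices on `S(V) ⊗ Λ(V)`, as an `F`-subspace. -/
def invSL (F : Type) [Field F] (n : ℕ) (P : Set (Matrix (Fin n) (Fin n) F)) :
    Submodule F (SL F n) where
  carrier := {f | ∀ g ∈ P, tAct F n g f = f}
  add_mem' := fun ha hb g hg => by rw [map_add, ha g hg, hb g hg]
  zero_mem' := fun g hg => map_zero _
  smul_mem' := fun c f hf g hg => by rw [map_smul, hf g hg]

/-- the invariants of `S(V) ⊗ Λ(V) ⊗ Det^k`, i.e. elements with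
`det(g)^k (g·f) = f` for all `g ∈ P`. -/
def invSLtw (F : Type) [Field F] (n k : ℕ) (P : Set (Matrix (Fin n) (Fin n) F)) :
    Submodule F (SL F n) where
  carrier := {f | ∀ g ∈ P, g.det ^ k • tAct F n g f = f}
  add_mem' := fun ha hb g hg => by rw [map_add, smul_add, ha g hg, hb g hg]
  zero_mem' := fun g hg => by rw [map_zero, smul_zero]
  smul_mem' := fun c f hf g hg => by rw [map_smul, smul_comm, hf g hg]

/-- the invariants of a set of matrices on `S(V)`, as an `F`-subalgebra. -/
def invS (F : Type) [Field F] (n : ℕ) (P : Set (Matrix (Fin n) (Fin n) F)) :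
    Subalgebra F (SV F n) where
  carrier := {f | ∀ g ∈ P, gAct F n g f = f}
  mul_mem' := fun ha hb g hg => by rw [map_mul, ha g hg, hb g hg]
  one_mem' := fun g hg => map_one _
  add_mem' := fun ha hb g hg => by rw [map_add, ha g hg, hb g hg]
  zero_mem' := fun g hg => map_zero _
  algebraMap_mem' := fun c g hg => (gAct F n g).commutes c

/-- `v_{i,j+1}` (0-indexed `j`) for the composition `I`. -/
def vij (F : Type) [Field F] [Fintype F] (n : ℕ) (I : Composition n)
    (i : Fin I.length) (j : ℕ) : SV F n :=
  linProd F n (I.sizeUpTo i) (I.sizeUpTo i + j)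

/-- `θ_i = L_{n_i}(v_{i,1},…,v_{i,n_i})`. -/
def theta (F : Type) [Field F] [Fintype F] (n : ℕ) (I : Composition n)
    (i : Fin I.length) : SV F n :=
  MvPolynomial.aeval (fun t : Fin (I.blocksFun i) => vij F n I i t)
    (Lm F (I.blocksFun i) (I.blocksFun i))

/-- `q_{i,k} = Q_{n_i,k}(v_{i,1},…,v_{i,n_i})`, given the Dickson polynomials `Q`. -/
def qInv (F : Type) [Field F] [Fintype F] (n : ℕ) (Q : (m : ℕ) → ℕ → SV F m)
    (I : Composition n) (i : Fin I.length) (k : ℕ) : SV F n :=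
  MvPolynomial.aeval (fun t : Fin (I.blocksFun i) => vij F n I i t)
    (Q (I.blocksFun i) k)

/-- the index of the block (0-indexed) of the composition `I` containing `a`. -/
def blkIdx (n : ℕ) (I : Composition n) (a : ℕ) : ℕ :=
  ((range I.length).filter fun i => I.sizeUpTo (i + 1) ≤ a).card

/-- the parabolic subgroup `P_I`: invertible block upper-triangular matrices. -/
def PIset (F : Type) [Field F] (n : ℕ) (I : Composition n) :
    Set (Matrix (Fin n) (Fin n) F) :=
  {g | IsUnit g.det ∧ ∀ a b : Fin n, blkIdx n I b < blkIdx n I a → g a b = 0}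

/-- the subgroup `K_I ≤ P_I`: block upper-triangular with all diagonal blocks
of determinant `1`. -/
def KIset (F : Type) [Field F] (n : ℕ) (I : Composition n) :
    Set (Matrix (Fin n) (Fin n) F) :=
  {g | IsUnit g.det ∧ (∀ a b : Fin n, blkIdx n I b < blkIdx n I a → g a b = 0) ∧
    ∀ i : Fin I.length,
      Matrix.det (Matrix.of fun a b : Fin (I.blocksFun i) =>
        g (I.embedding i a) (I.embedding i b)) = 1}

/-- the unipotent subgroup `U_n` of uni-uppertriangular matrices. -/
def Uset (F : Type) [Field F] (n : ℕ) : Set (Matrix (Fin n) (Fin n) F) :=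
  {g | (∀ a b : Fin n, b < a → g a b = 0) ∧ ∀ a : Fin n, g a a = 1}

/-- `SL_n(q)`. -/
def SLset (F : Type) [Field F] (n : ℕ) : Set (Matrix (Fin n) (Fin n) F) :=
  {g | g.det = 1}

/-- `GL_n(q)`. -/
def GLset (F : Type) [Field F] (n : ℕ) : Set (Matrix (Fin n) (Fin n) F) :=
  {g | IsUnit g.det}

/-- the bigraded piece `S^i(V) ⊗ Λ^j(V)` of `S(V) ⊗ Λ(V)`. -/
def piece (F : Type) [Field F] (n i j : ℕ) : Submodule F (SL F n) :=
  LinearMap.range (TensorProduct.map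
    (MvPolynomial.homogeneousSubmodule (Fin n) F i).subtype
    (LinearMap.range (ExteriorAlgebra.ι F (M := Fin n → F)) ^ j).subtype)

/-- the Hilbert series in `ℤ[s][[t]]` of a bigraded subspace `W` of `S(V) ⊗ Λ(V)`:
the coefficient of `t^i` is `∑_{j=0}^n dim (W ∩ (S^i ⊗ Λ^j)) s^j`. -/
def Hser (F : Type) [Field F] (n : ℕ) (W : Submodule F (SL F n)) :
    PowerSeries (Polynomial ℤ) :=
  PowerSeries.mk fun i => ∑ j ∈ range (n + 1),
    Polynomial.C (Module.finrank F ↥(W ⊓ piece F n i j) : ℤ) * Polynomial.X ^ j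

/-- the Hilbert series in `ℤ[[t]]` of a graded subalgebra of `S(V)`. -/
def HserS (F : Type) [Field F] (n : ℕ) (W : Subalgebra F (SV F n)) :
    PowerSeries ℤ :=
  PowerSeries.mk fun d =>
    (Module.finrank F ↥(Subalgebra.toSubmodule W ⊓ MvPolynomial.homogeneousSubmodule (Fin n) F d) : ℤ)

/-- the index set for Mui-type basis elements attached to the composition `I`:
pairs `(i, B)` with `B = {b_1 < ⋯ < b_j} ⊆ {0,…,m_{i+1}−1}` nonempty and
`max B ≥ m_i` (0-indexed `i`). -/
def Adm (n : ℕ) (I : Composition n) : Finset (Fin I.length × Finset ℕ) :=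
  (Finset.univ ×ˢ (range n).powerset).filter fun x =>
    x.2 ⊆ range (I.sizeUpTo ((x.1 : ℕ) + 1)) ∧ x.2.Nonempty ∧ ∃ b ∈ x.2, I.sizeUpTo (x.1 : ℕ) ≤ b

/-! ### Linear substitutions on `T ⊗ Λ(V)` -/

theorem sum_mul_self_eq_zero {ι A : Type*} [Ring A] (w : ι → A) (h0 : ∀ i, w i * w i = 0)
    (h1 : ∀ i j, w i * w j + w j * w i = 0) (s : Finset ι) :
    (∑ i ∈ s, w i) * (∑ i ∈ s, w i) = 0 := by
  classical
  induction s using Finset.induction_on with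
  | empty => simp
  | insert a s ha ih =>
    rw [sum_insert ha]
    have : w a * (∑ i ∈ s, w i) + (∑ i ∈ s, w i) * w a = 0 := by
      rw [mul_sum, sum_mul, ← sum_add_distrib]
      exact sum_eq_zero fun i _ => h1 a i
    calc _ = w a * w a + (w a * (∑ i ∈ s, w i) + (∑ i ∈ s, w i) * w a)
          + (∑ i ∈ s, w i) * (∑ i ∈ s, w i) := by noncomm_ring
      _ = 0 := by rw [this, ih, h0]; simp

section Exterior

variable {F : Type} [Field F] {n : ℕ} {T : Type} [CommRing T] [Algebra F T]

/-- The generator `y_i` of the exterior algebra. -/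
def yGen (F : Type) [Field F] {n : ℕ} (i : Fin n) : LV F n :=
  ExteriorAlgebra.ι F (Pi.single i (1 : F))

/-- The one-form `∑ v_i y_i` with coefficients in `T`. -/
def oneForm (F : Type) [Field F] {n : ℕ} {T : Type} [CommRing T] [Algebra F T] :
    (Fin n → T) →ₗ[T] T ⊗[F] LV F n :=
  ∑ i, (LinearMap.proj i : (Fin n → T) →ₗ[T] T).smulRight ((1 : T) ⊗ₜ[F] yGen F i)

theorem oneForm_apply (v : Fin n → T) :
    oneForm F v = ∑ i, v i • ((1 : T) ⊗ₜ[F] yGen F i) := by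
  simp [oneForm]

theorem oneForm_single (i : Fin n) :
    oneForm F (Pi.single i (1 : T)) = (1 : T) ⊗ₜ[F] yGen F i := by
  rw [oneForm_apply, sum_eq_single i] <;> simp +contextual

theorem oneForm_sq (v : Fin n → T) : oneForm F v * oneForm F v = 0 := by
  rw [oneForm_apply]
  refine sum_mul_self_eq_zero _ (fun i => ?_) (fun i j => ?_) _
  · simp [yGen]
  · have := ExteriorAlgebra.ι_add_mul_swap (R := F) (M := Fin n → F)
      (Pi.single i 1) (Pi.single j 1)
    simp only [smul_mul_smul_comm, Algebra.TensorProduct.tmul_mul_tmul, mul_one, mul_comm (v j),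
      ← smul_add, ← TensorProduct.tmul_add, yGen, this, TensorProduct.tmul_zero, smul_zero]

theorem oneForm_algebraMap (v : Fin n → F) :
    oneForm F (fun i => algebraMap F T (v i)) = (1 : T) ⊗ₜ[F] ExteriorAlgebra.ι F v := by
  rw [oneForm_apply]
  have : v = ∑ i, v i • Pi.single i (1 : F) := by
    ext j; simp [Finset.sum_apply, Pi.single_apply]
  conv_rhs => rw [this, map_sum, TensorProduct.tmul_sum]
  refine sum_congr rfl fun i _ => ?_
  rw [map_smul, TensorProduct.tmul_smul, algebraMap_smul]; rfl

/-- The `T`-algebra endomorphism of `T ⊗ Λ(V)` with `y_j ↦ ∑_i g_{ij} y_i`. -/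
def linSub (g : Matrix (Fin n) (Fin n) T) : T ⊗[F] LV F n →ₐ[T] T ⊗[F] LV F n :=
  Algebra.TensorProduct.lift (Algebra.ofId T _)
    (ExteriorAlgebra.lift F
      ⟨((oneForm F ∘ₗ g.mulVecLin).restrictScalars F) ∘ₗ
          ((Algebra.linearMap F T).compLeft (Fin n)),
        fun _ => oneForm_sq _⟩)
    (fun x _ => Algebra.commutes x _)

theorem linSub_tmul_ι (g : Matrix (Fin n) (Fin n) T) (v : Fin n → F) :
    linSub g ((1 : T) ⊗ₜ[F] ExteriorAlgebra.ι F v) =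
      oneForm F (g.mulVec fun i => algebraMap F T (v i)) := by
  refine (Algebra.TensorProduct.lift_tmul _ _ _ _ _).trans ?_
  rw [map_one, one_mul]
  exact ExteriorAlgebra.lift_ι_apply _ _ _ _

theorem linSub_yGen (g : Matrix (Fin n) (Fin n) T) (j : Fin n) :
    linSub g ((1 : T) ⊗ₜ[F] yGen F j) = oneForm F (g.col j) := by
  rw [yGen, linSub_tmul_ι]
  congr 1
  ext i
  simp [Matrix.mulVec, dotProduct, Pi.single_apply, apply_ite]

theorem linSub_oneForm (g : Matrix (Fin n) (Fin n) T) (v : Fin n → T) :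
    linSub g (oneForm F v) = oneForm F (g.mulVec v) := by
  rw [oneForm_apply, map_sum]
  simp only [map_smul, linSub_yGen]
  simp only [← map_smul, ← map_sum]
  congr 1
  ext i
  simp [Matrix.mulVec, dotProduct, Matrix.col, mul_comm]

theorem tensor_algHom_ext {C : Type} [Ring C] [Algebra F C] {f g : T ⊗[F] LV F n →ₐ[F] C}
    (h1 : ∀ t : T, f (t ⊗ₜ 1) = g (t ⊗ₜ 1))
    (h2 : ∀ v, f (1 ⊗ₜ ExteriorAlgebra.ι F v) = g (1 ⊗ₜ ExteriorAlgebra.ι F v)) : f = g := by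
  apply Algebra.TensorProduct.ext
  · ext t; exact h1 t
  · apply ExteriorAlgebra.hom_ext
    exact LinearMap.ext h2

theorem linSub_tmul_one (g : Matrix (Fin n) (Fin n) T) (t : T) :
    linSub g (t ⊗ₜ[F] (1 : LV F n)) = t ⊗ₜ 1 :=
  (linSub g).commutes t

theorem linSub_linSub (g h : Matrix (Fin n) (Fin n) T) (f : T ⊗[F] LV F n) :
    linSub g (linSub h f) = linSub (g * h) f := by
  have : (((linSub g).comp (linSub h)).restrictScalars F : T ⊗[F] LV F n →ₐ[F] T ⊗[F] LV F n) =
      (linSub (g * h)).restrictScalars F := by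
    refine tensor_algHom_ext (fun t => ?_) (fun v => ?_)
    · simp [linSub_tmul_one]
    · simp [linSub_tmul_ι, linSub_oneForm]
  exact DFunLike.congr_fun this f

/-- Application of an endomorphism of `T` to the coefficients of `T ⊗ Λ(V)`. -/
def coeffMap (s : T →ₐ[F] T) : T ⊗[F] LV F n →ₐ[F] T ⊗[F] LV F n :=
  Algebra.TensorProduct.map s (AlgHom.id F _)

@[simp]
theorem coeffMap_tmul (s : T →ₐ[F] T) (t : T) (w : LV F n) :
    coeffMap s (t ⊗ₜ[F] w) = s t ⊗ₜ w := rfl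

theorem coeffMap_oneForm (s : T →ₐ[F] T) (v : Fin n → T) :
    coeffMap s (oneForm F v) = oneForm F (fun i => s (v i)) := by
  simp [oneForm_apply, TensorProduct.smul_tmul']

theorem coeffMap_linSub (s : T →ₐ[F] T) (g : Matrix (Fin n) (Fin n) T) (f : T ⊗[F] LV F n) :
    coeffMap s (linSub g f) = linSub (g.map s) (coeffMap s f) := by
  have : ((coeffMap s).comp ((linSub g).restrictScalars F) : T ⊗[F] LV F n →ₐ[F] _) =
      ((linSub (g.map s)).restrictScalars F).comp (coeffMap s) := by
    refine tensor_algHom_ext (fun t => ?_) (fun v => ?_)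
    · simp [linSub_tmul_one]
    · simp only [AlgHom.comp_apply, AlgHom.restrictScalars_apply, linSub_tmul_ι, coeffMap_tmul,
        map_one, coeffMap_oneForm]
      congr 1
      ext i
      simp [Matrix.mulVec, dotProduct]
  exact DFunLike.congr_fun this f

theorem tAct_eq (g : Matrix (Fin n) (Fin n) F) (f : SL F n) :
    tAct F n g f = linSub (g.map C) (coeffMap (gAct F n g) f) := by
  have : tAct F n g =
      ((linSub (g.map C)).restrictScalars F).comp (coeffMap (gAct F n g)) := by
    refine tensor_algHom_ext (fun t => ?_) (fun v => ?_)
    · simp [linSub_tmul_one, tAct, -Algebra.TensorProduct.map_tmul, Algebra.TensorProduct.map_tmul]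
    · simp only [AlgHom.comp_apply, AlgHom.restrictScalars_apply, linSub_tmul_ι, coeffMap_tmul,
        map_one, tAct, Algebra.TensorProduct.map_tmul, eAct, ExteriorAlgebra.map_apply_ι]
      rw [← oneForm_algebraMap]
      congr 1
      ext1 i
      simp [Matrix.mulVec, dotProduct, MvPolynomial.algebraMap_eq]
  rw [this]; rfl

/-! ### The monomial basis and minors -/

/-- The monomial `y_{a_1} ⋯ y_{a_k}`. -/
def yWord (F : Type) [Field F] {n k : ℕ} (a : Fin k → Fin n) : LV F n :=
  (List.ofFn fun i => yGen F (a i)).prod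

/-- The basis `y_S` of the exterior algebra. -/
def yBasis (F : Type) [Field F] (n : ℕ) : Module.Basis (Finset (Fin n)) F (LV F n) :=
  (Pi.basisFun F (Fin n)).ExteriorAlgebra

theorem yBasis_eq_yWord {S : Finset (Fin n)} {k : ℕ} (h : S.card = k) :
    yBasis F n S = yWord F (S.orderEmbOfFin h) := by
  rw [yBasis, ExteriorAlgebra.basis_apply_ofCard _ h, ExteriorAlgebra.ιMulti_family,
    ExteriorAlgebra.ιMulti_apply, yWord]
  congr 2
  ext i
  simp [yGen, Set.powersetCard.ofFinEmbEquiv_symm_apply]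

/-- The basis `y_S` of `T ⊗ Λ(V)` over `T`. -/
def tBasis (F : Type) [Field F] (n : ℕ) (T : Type) [CommRing T] [Algebra F T] :
    Module.Basis (Finset (Fin n)) T (T ⊗[F] LV F n) :=
  Algebra.TensorProduct.basis T (yBasis F n)

theorem tBasis_apply (S : Finset (Fin n)) : tBasis F n T S = 1 ⊗ₜ yBasis F n S := by
  simp [tBasis]

theorem tBasis_repr_tmul (t : T) (w : LV F n) (S : Finset (Fin n)) :
    (tBasis F n T).repr (t ⊗ₜ w) S = t * algebraMap F T ((yBasis F n).repr w S) := by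
  simp [tBasis]

theorem prod_oneForm {k : ℕ} (v : Fin k → Fin n → T) :
    (List.ofFn fun j => oneForm F (v j)).prod =
      ∑ s : Set.powersetCard (Fin n) k,
        (Matrix.of fun i j => v i ((s : Finset (Fin n)).orderEmbOfFin s.2 j)).det •
          tBasis F n T s := by
  let Ξ : ExteriorAlgebra T (Fin n → T) →ₐ[T] T ⊗[F] LV F n :=
    ExteriorAlgebra.lift T ⟨oneForm F, fun v => oneForm_sq v⟩
  have hΞ : ∀ w : Fin k → Fin n → T, Ξ (ExteriorAlgebra.ιMulti T k w) =
      (List.ofFn fun j => oneForm F (w j)).prod := by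
    intro w
    rw [ExteriorAlgebra.ιMulti_apply, map_list_prod, List.map_ofFn]
    congr 2
    ext j
    simp [Ξ]
  rw [← hΞ]
  have h := ((Pi.basisFun T (Fin n)).exteriorPower k).sum_repr (exteriorPower.ιMulti T k v)
  have h2 := congrArg (fun z : ⋀[T]^k (Fin n → T) => Ξ (z : ExteriorAlgebra T (Fin n → T))) h
  simp only [AddSubmonoidClass.coe_finsetSum, map_sum] at h2
  rw [exteriorPower.ιMulti_apply_coe] at h2
  rw [← h2]
  refine sum_congr rfl fun s _ => ?_
  rw [Submodule.coe_smul, map_smul, exteriorPower.basis_repr_apply,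
    exteriorPower.ιMultiDual_apply_ιMulti]
  congr 1
  rw [exteriorPower.basis_apply, exteriorPower.ιMulti_family_apply_coe,
    ExteriorAlgebra.ιMulti_family, hΞ, tBasis_apply, yBasis_eq_yWord s.2, yWord]
  have : ∀ l : List (LV F n), (1 : T) ⊗ₜ[F] l.prod =
      (l.map fun w => (1 : T) ⊗ₜ[F] w).prod := fun l =>
    map_list_prod (Algebra.TensorProduct.includeRight : LV F n →ₐ[F] T ⊗[F] LV F n) l
  rw [this, List.map_ofFn]
  congr 2
  ext j
  simp [oneForm_single, Set.powersetCard.ofFinEmbEquiv_symm_apply]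

/-- The minor of `g` with rows `R` and columns `S`, junk value `0` if the cardinalities differ. -/
def minor (g : Matrix (Fin n) (Fin n) T) (R S : Finset (Fin n)) : T :=
  if h : R.card = S.card then
    (g.submatrix (R.orderEmbOfFin h) (S.orderEmbOfFin rfl)).det
  else 0

theorem linSub_tBasis (g : Matrix (Fin n) (Fin n) T) (S : Finset (Fin n)) :
    linSub g (tBasis F n T S) = ∑ R, minor g R S • tBasis F n T R := by
  have h1 : linSub g (tBasis F n T S) =
      (List.ofFn fun j => oneForm F (g.col (S.orderEmbOfFin rfl j))).prod := by
    have : ∀ l : List (LV F n), (1 : T) ⊗ₜ[F] l.prod =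
        (l.map fun w => (1 : T) ⊗ₜ[F] w).prod := fun l =>
      map_list_prod (Algebra.TensorProduct.includeRight : LV F n →ₐ[F] T ⊗[F] LV F n) l
    rw [tBasis_apply, yBasis_eq_yWord rfl, yWord, this, map_list_prod, List.map_ofFn,
      List.map_ofFn]
    congr 2
    ext j
    simp [linSub_yGen]
  rw [h1, prod_oneForm]
  have h2 : ∀ s : Set.powersetCard (Fin n) S.card,
      (Matrix.of fun i j => g.col (S.orderEmbOfFin rfl i)
        ((s : Finset (Fin n)).orderEmbOfFin s.2 j)).det • tBasis F n T s =
      minor g (s : Finset (Fin n)) S • tBasis F n T s := by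
    intro s
    have hs : (s : Finset (Fin n)).card = S.card := s.2
    rw [minor, dif_pos hs, ← Matrix.det_transpose]
    rfl
  simp only [h2]
  symm
  rw [← sum_subset (subset_univ (univ.filter fun R : Finset (Fin n) => R.card = S.card))]
  · exact Finset.sum_subtype _ (by simp [Set.powersetCard.mem_iff]) _
  · intro R _ hR
    rw [minor, dif_neg (by simpa using hR), zero_smul]

end Exterior

theorem neg_one_pow_add_two_mul {R : Type*} [Ring R] (a k : ℕ) :
    (-1 : R) ^ (a + 2 * k) = (-1) ^ a := by
  rw [pow_add, pow_mul]; simp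

/-! ### Products of monomials and the Laplace expansion -/

theorem sort_insert_max {m : ℕ} {S : Finset ℕ} (h : ∀ s ∈ S, s < m) :
    (insert m S).sort (· ≤ ·) = S.sort (· ≤ ·) ++ [m] := by
  have hm : m ∉ S := fun hm => lt_irrefl _ (h m hm)
  refine List.Perm.eq_of_pairwise' (r := (· ≤ ·)) (pairwise_sort _ _) ?_ ?_
  · rw [List.pairwise_append]
    refine ⟨pairwise_sort _ _, by simp, ?_⟩
    intro a ha b hb
    rw [List.mem_singleton.1 hb]
    exact (h a ((mem_sort _).1 ha)).le
  · rw [List.perm_ext_iff_of_nodup (sort_nodup _ _)]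
    · intro a; simp [or_comm]
    · rw [List.nodup_append]
      refine ⟨sort_nodup _ _, by simp, ?_⟩
      intro a ha b hb
      rw [List.mem_singleton.1 hb]
      exact (h a ((mem_sort _).1 ha)).ne

section Laplace

variable {F : Type} [Field F] {n : ℕ} {T : Type} [CommRing T] [Algebra F T]

theorem yV_mul_swap (a b : ℕ) : yV F n a * yV F n b = -(yV F n b * yV F n a) := by
  unfold yV
  split_ifs
  · exact eq_neg_of_add_eq_zero_left (ExteriorAlgebra.ι_add_mul_swap _ _)
  all_goals simp

theorem yV_mul_list (m : ℕ) (l : List ℕ) :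
    yV F n m * (l.map (yV F n)).prod = (-1 : F) ^ l.length • ((l.map (yV F n)).prod * yV F n m) := by
  induction l with
  | nil => simp
  | cons a l ih =>
    rw [List.map_cons, List.prod_cons, ← mul_assoc, yV_mul_swap, neg_mul, mul_assoc, ih,
      List.length_cons, pow_succ, mul_smul_comm, mul_assoc, mul_neg_one, neg_smul]

theorem yProd_insert_max {m : ℕ} {S : Finset ℕ} (h : ∀ s ∈ S, s < m) :
    yProd F n (insert m S) = yProd F n S * yV F n m := by
  rw [yProd, sort_insert_max h]
  simp [yProd]

/-- The sign of the shuffle putting `S` in front of its complement. -/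
def shuffleSign (F : Type) [Field F] (S : Finset ℕ) : F :=
  (-1) ^ (S.card * (S.card - 1) / 2 + ∑ s ∈ S, s)

theorem yProd_mul_compl (m : ℕ) (S : Finset ℕ) (hS : S ⊆ range m) :
    yProd F n S * yProd F n (range m \ S) = shuffleSign F S • yProd F n (range m) := by
  induction m generalizing S with
  | zero =>
    obtain rfl : S = ∅ := by simpa using hS
    simp [yProd, shuffleSign]
  | succ m ih =>
    have hr : yProd F n (range (m + 1)) = yProd F n (range m) * yV F n m := by
      rw [range_add_one, yProd_insert_max (by simp)]
    by_cases hm : m ∈ S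
    · obtain ⟨S', hmS', rfl⟩ : ∃ S', m ∉ S' ∧ S = insert m S' :=
        ⟨S.erase m, notMem_erase _ _, (insert_erase hm).symm⟩
      have hS' : S' ⊆ range m := by
        intro s hs
        have h1 := mem_range.1 (hS (mem_insert_of_mem hs))
        have h2 : s ≠ m := fun h => hmS' (h ▸ hs)
        exact mem_range.2 (by omega)
      have h1 : range (m + 1) \ insert m S' = range m \ S' := by
        ext x
        simp only [mem_sdiff, mem_range, mem_insert]
        have : x ∈ S' → x < m := fun h => mem_range.1 (hS' h)
        grind
      rw [h1, yProd_insert_max fun s hs => mem_range.1 (hS' hs), hr, mul_assoc]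
      conv_lhs => rw [yProd.eq_def F n (range m \ S'), yV_mul_list, ← yProd]
      rw [mul_smul_comm, ← mul_assoc, ih S' hS', smul_mul_assoc, smul_smul, length_sort,
        card_sdiff_of_subset hS', card_range]
      congr 1
      have hle : S'.card ≤ m := by simpa using card_le_card hS'
      rw [shuffleSign, shuffleSign, card_insert_of_notMem hmS', sum_insert hmS', ← pow_add,
        Nat.triangle_succ, ← neg_one_pow_add_two_mul _ S'.card]
      congr 1
      omega
    · have hS' : S ⊆ range m := by
        intro s hs
        have h1 := mem_range.1 (hS hs)
        have h2 : s ≠ m := fun h => hm (h ▸ hs)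
        exact mem_range.2 (by omega)
      have h1 : range (m + 1) \ S = insert m (range m \ S) := by
        ext x
        simp only [mem_sdiff, mem_range, mem_insert]
        grind
      rw [h1, yProd_insert_max (by simp +contextual), ← mul_assoc, ih S hS', hr, smul_mul_assoc]

theorem yV_val (i : Fin n) : yV F n i = yGen F i := by
  simp [yV, yGen]

theorem yProd_map (S : Finset (Fin n)) :
    yProd F n (S.map Fin.valEmbedding) = yBasis F n S := by
  have h : (S.map Fin.valEmbedding).sort (· ≤ ·) =
      List.ofFn fun i => ((S.orderEmbOfFin rfl i : Fin n) : ℕ) := by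
    refine List.Perm.eq_of_pairwise' (r := (· ≤ ·)) (pairwise_sort _ _) ?_ ?_
    · rw [List.pairwise_ofFn]
      intro i j hij
      exact ((S.orderEmbOfFin rfl).strictMono hij).le
    · rw [List.perm_ext_iff_of_nodup (sort_nodup _ _)]
      · intro a
        rw [mem_sort, mem_map, List.mem_ofFn]
        constructor
        · rintro ⟨b, hb, rfl⟩
          have : b ∈ Set.range (S.orderEmbOfFin rfl) := by
            rw [range_orderEmbOfFin]; exact hb
          obtain ⟨i, hi⟩ := this
          exact ⟨i, by simp [hi]⟩
        · rintro ⟨i, rfl⟩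
          exact ⟨_, orderEmbOfFin_mem S rfl i, rfl⟩
      · rw [List.nodup_ofFn]
        exact Fin.val_injective.comp (S.orderEmbOfFin rfl).injective
  rw [yProd, h, yBasis_eq_yWord rfl, List.map_ofFn, yWord]
  congr 2
  ext i
  exact yV_val _

theorem range_eq_map_univ (n : ℕ) : range n = (univ : Finset (Fin n)).map Fin.valEmbedding := by
  ext x
  simp only [mem_range, mem_map, mem_univ, true_and]
  exact ⟨fun h => ⟨⟨x, h⟩, rfl⟩, fun ⟨a, ha⟩ => ha ▸ a.2⟩

theorem range_sdiff_map (S : Finset (Fin n)) :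
    range n \ S.map Fin.valEmbedding = Sᶜ.map Fin.valEmbedding := by
  rw [range_eq_map_univ, ← Finset.map_sdiff, compl_eq_univ_sdiff]

theorem tBasis_mul_compl (S : Finset (Fin n)) :
    tBasis F n T S * tBasis F n T Sᶜ =
      algebraMap F T (shuffleSign F (S.map Fin.valEmbedding)) • tBasis F n T univ := by
  rw [tBasis_apply, tBasis_apply, tBasis_apply, Algebra.TensorProduct.tmul_mul_tmul, ← yProd_map,
    ← yProd_map, ← range_sdiff_map, yProd_mul_compl, ← yProd_map univ, ← range_eq_map_univ,
    TensorProduct.tmul_smul, algebraMap_smul, mul_one]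
  rw [range_eq_map_univ]
  exact map_subset_map.2 (subset_univ _)

theorem tBasis_mul_of_not_disjoint {S R : Finset (Fin n)} (h : ¬ Disjoint S R) :
    tBasis F n T S * tBasis F n T R = 0 := by
  rw [tBasis_apply, tBasis_apply, Algebra.TensorProduct.tmul_mul_tmul]
  have := ExteriorAlgebra.basis_mul_of_not_disjoint (Pi.basisFun F (Fin n))
    (Set.powersetCard.prodEquiv.symm S).2 (Set.powersetCard.prodEquiv.symm R).2 h
  rw [yBasis]
  erw [this]
  simp

theorem minor_of_card_ne (g : Matrix (Fin n) (Fin n) T) {R S : Finset (Fin n)}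
    (h : R.card ≠ S.card) : minor g R S = 0 := dif_neg h

theorem minor_eq (g : Matrix (Fin n) (Fin n) T) {R S : Finset (Fin n)} {k : ℕ}
    (hR : R.card = k) (hS : S.card = k) :
    minor g R S = (g.submatrix (R.orderEmbOfFin hR) (S.orderEmbOfFin hS)).det := by
  subst hS
  exact dif_pos hR

theorem minor_transpose (g : Matrix (Fin n) (Fin n) T) (R S : Finset (Fin n)) :
    minor g.transpose R S = minor g S R := by
  by_cases h : R.card = S.card
  · rw [minor_eq g.transpose h rfl, minor_eq g rfl h, ← Matrix.det_transpose]
    rfl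
  · rw [minor_of_card_ne _ h, minor_of_card_ne _ (Ne.symm h)]

theorem minor_univ (g : Matrix (Fin n) (Fin n) T) : minor g univ univ = g.det := by
  have h : ∀ i, (univ : Finset (Fin n)).orderEmbOfFin (card_fin n) i = i := fun i =>
    (DFunLike.congr_fun (orderEmbOfFin_unique' (card_fin n) (f := RelEmbedding.refl _)
      fun x => mem_univ x) i).symm
  rw [minor_eq g (card_fin n) (card_fin n)]
  congr 1
  ext i j
  simp [h]

theorem linSub_tBasis_univ (g : Matrix (Fin n) (Fin n) T) :
    linSub g (tBasis F n T univ) = g.det • tBasis F n T univ := by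
  rw [linSub_tBasis, sum_eq_single univ, minor_univ]
  · intro R _ hR
    rw [minor_of_card_ne, zero_smul]
    exact fun h => hR (eq_univ_of_card R (by simpa using h))
  · simp

theorem linSub_tBasis_empty (g : Matrix (Fin n) (Fin n) T) :
    linSub g (tBasis F n T ∅) = tBasis F n T ∅ := by
  rw [linSub_tBasis, sum_eq_single ∅, minor_eq g card_empty card_empty]
  · simp
  · intro R _ hR
    rw [minor_of_card_ne, zero_smul]
    simpa using hR
  · simp

/-- The Laplace expansion of a determinant along several rows, together with the vanishing of
the expansions with repeated rows. -/
theorem sum_minor_mul_minor_compl (g : Matrix (Fin n) (Fin n) T) {R B : Finset (Fin n)}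
    (hRB : R.card = B.card) :
    ∑ S, algebraMap F T (shuffleSign F (S.map Fin.valEmbedding)) *
        (minor g R S * minor g Bᶜ Sᶜ) =
      if R = B then algebraMap F T (shuffleSign F (B.map Fin.valEmbedding)) * g.det else 0 := by
  have hL : linSub g.transpose (tBasis F n T R * tBasis F n T Bᶜ) =
      (∑ S, algebraMap F T (shuffleSign F (S.map Fin.valEmbedding)) *
        (minor g R S * minor g Bᶜ Sᶜ)) • tBasis F n T univ := by
    rw [map_mul, linSub_tBasis, linSub_tBasis, sum_mul, sum_smul]
    refine sum_congr rfl fun S _ => ?_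
    rw [mul_sum, sum_eq_single Sᶜ]
    · rw [smul_mul_smul_comm, tBasis_mul_compl, smul_smul, minor_transpose, minor_transpose,
        mul_comm]
    · intro S' _ hS'
      rw [smul_mul_smul_comm, minor_transpose, minor_transpose]
      by_cases h1 : R.card = S.card
      · by_cases h2 : Bᶜ.card = S'.card
        · rw [tBasis_mul_of_not_disjoint, smul_zero]
          intro hd
          refine hS' (eq_of_subset_of_card_le (subset_compl_comm.1 hd.le_compl_right) ?_)
          rw [← h2, card_compl, card_compl, ← h1, hRB]
        · rw [minor_of_card_ne g h2, mul_zero, zero_smul]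
      · rw [minor_of_card_ne g h1, zero_mul, zero_smul]
    · simp
  have hrepr : ∀ a b : T, a • tBasis F n T univ = b • tBasis F n T univ → a = b := by
    intro a b h
    have := congrArg (fun z => (tBasis F n T).repr z univ) h
    simpa using this
  apply hrepr
  rw [← hL]
  split_ifs with h
  · rw [h, tBasis_mul_compl, map_smul, linSub_tBasis_univ, smul_smul, Matrix.det_transpose]
  · rw [tBasis_mul_of_not_disjoint, map_zero, zero_smul]
    intro hd
    refine h (eq_of_subset_of_card_le ?_ hRB.ge)
    have := hd.le_compl_right
    rwa [compl_compl] at this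

end Laplace

section Mui

variable {F : Type} [Field F] {n : ℕ}

/-- The Moore matrix `(x_t^{q^c})`. -/
def mooreMat (F : Type) [Field F] (q n : ℕ) : Matrix (Fin n) (Fin n) (SV F n) :=
  Matrix.of fun c t => X t ^ q ^ (c : ℕ)

theorem subDet_eq (q : ℕ) {k : ℕ} {R C : Finset ℕ} (r c : Fin k → ℕ) (hr : StrictMono r)
    (hc : StrictMono c) (hR : ∀ i, r i ∈ R) (hC : ∀ i, c i ∈ C) (hRk : R.card = k)
    (hCk : C.card = k) :
    subDet F q n R C = (Matrix.of fun i j => xV F n (c j) ^ q ^ r i).det := by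
  subst hRk
  rw [subDet, dif_pos hCk, ← orderEmbOfFin_unique rfl hR hr, ← orderEmbOfFin_unique hCk hC hc]

theorem xV_val (i : Fin n) : xV F n i = X i := by simp [xV]

theorem subDet_map (q : ℕ) {R S : Finset (Fin n)} (h : R.card = S.card) :
    subDet F q n (R.map Fin.valEmbedding) (S.map Fin.valEmbedding) =
      minor (mooreMat F q n) R S := by
  rw [minor_eq _ h rfl, subDet_eq (k := S.card) q (fun i => R.orderEmbOfFin h i)
    (fun i => S.orderEmbOfFin rfl i) (fun _ _ hij => (R.orderEmbOfFin h).strictMono hij)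
    (fun _ _ hij => (S.orderEmbOfFin rfl).strictMono hij)
    (fun i => mem_map_of_mem Fin.valEmbedding (orderEmbOfFin_mem R h i))
    (fun i => mem_map_of_mem Fin.valEmbedding (orderEmbOfFin_mem S rfl i)) (by simpa) (by simp)]
  simp only [xV_val]
  rfl

theorem muiM_eq (q : ℕ) (B : Finset (Fin n)) :
    MuiM F q n n (B.map Fin.valEmbedding) =
      ∑ S ∈ (univ : Finset (Fin n)).powersetCard B.card,
        (algebraMap F (SV F n) (shuffleSign F (S.map Fin.valEmbedding)) *
          minor (mooreMat F q n) Bᶜ Sᶜ) • tBasis F n (SV F n) S := by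
  rw [MuiM]
  conv_lhs =>
    rw [range_eq_map_univ n, powersetCard_map, sum_map, ← range_eq_map_univ n, card_map]
  refine sum_congr rfl fun S hS => ?_
  have hS' := (mem_powersetCard.1 hS).2
  have : (mapEmbedding Fin.valEmbedding).toEmbedding S = S.map Fin.valEmbedding := rfl
  rw [this, range_sdiff_map, range_sdiff_map, subDet_map, yProd_map, mul_smul, algebraMap_smul,
    tBasis_apply, TensorProduct.smul_tmul' (minor _ _ _), smul_eq_mul, mul_one]
  · congr 1
    rw [shuffleSign, card_map, hS',
      ← neg_one_pow_add_two_mul (B.card * (B.card - 1) / 2 + _) B.card]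
    have := Nat.triangle_succ B.card
    rw [Nat.add_sub_cancel, mul_comm] at this
    congr 1
    omega
  · rw [card_compl, card_compl, hS']

theorem linSub_muiM (q : ℕ) (B : Finset (Fin n)) :
    linSub (mooreMat F q n) (MuiM F q n n (B.map Fin.valEmbedding)) =
      (algebraMap F (SV F n) (shuffleSign F (B.map Fin.valEmbedding)) *
        (mooreMat F q n).det) • tBasis F n (SV F n) B := by
  set A := mooreMat F q n
  have h0 : MuiM F q n n (B.map Fin.valEmbedding) =
      ∑ S, (algebraMap F (SV F n) (shuffleSign F (S.map Fin.valEmbedding)) *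
          minor A Bᶜ Sᶜ) • tBasis F n (SV F n) S := by
    rw [muiM_eq]
    refine sum_subset (subset_univ _) fun S _ hS => ?_
    rw [minor_of_card_ne, mul_zero, zero_smul]
    intro h
    apply hS
    rw [mem_powersetCard]
    refine ⟨subset_univ _, ?_⟩
    rw [card_compl, card_compl] at h
    have := card_le_univ B
    have := card_le_univ S
    omega
  rw [h0, map_sum]
  simp only [map_smul, linSub_tBasis, smul_sum, smul_smul]
  rw [sum_comm, sum_eq_single B]
  · rw [← sum_smul]
    congr 1
    have := sum_minor_mul_minor_compl (F := F) A (R := B) (B := B) rfl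
    rw [if_pos rfl] at this
    rw [← this]
    exact sum_congr rfl fun S _ => by ring
  · intro R _ hR
    rw [← sum_smul]
    by_cases h : R.card = B.card
    · have := sum_minor_mul_minor_compl (F := F) A (R := R) (B := B) h
      rw [if_neg hR] at this
      convert zero_smul (SV F n) (tBasis F n (SV F n) R)
      rw [← this]
      exact sum_congr rfl fun S _ => by ring
    · rw [sum_eq_zero, zero_smul]
      intro S _
      by_cases h1 : R.card = S.card
      · rw [minor_of_card_ne A (R := Bᶜ), mul_zero, zero_mul]
        rw [card_compl, card_compl]
        have := card_le_univ B
        have := card_le_univ S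
        omega
      · rw [minor_of_card_ne A h1, mul_zero]
  · simp

end Mui

/-! ### The Moore determinant -/

section Moore

variable {F : Type} [Field F] [Fintype F] {K : Type} [CommRing K] [Algebra F K]

theorem sum_smul_pow_card_pow {ι : Type*} (s : Finset ι) (c : ι → F) (x : ι → K) (i : ℕ) :
    (∑ k ∈ s, c k • x k) ^ Fintype.card F ^ i = ∑ k ∈ s, c k • x k ^ Fintype.card F ^ i := by
  have h (z : K) : (FiniteField.frobeniusAlgHom F K ^ i) z = z ^ Fintype.card F ^ i := by
    rw [AlgHom.coe_pow, FiniteField.coe_frobeniusAlgHom, pow_iterate]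
  simp_rw [← h, map_sum, map_smul]

theorem det_snoc_eq_zero [IsDomain K] {m : ℕ} (x : Fin m → K) (c : Fin m → F) :
    (Matrix.of fun i j : Fin (m + 1) =>
      (Fin.snoc x (∑ k, c k • x k) : Fin (m + 1) → K) j ^ Fintype.card F ^ (i : ℕ)).det = 0 := by
  rw [← Matrix.exists_mulVec_eq_zero_iff]
  refine ⟨Fin.snoc (fun k => algebraMap F K (c k)) (-1), fun h => ?_, ?_⟩
  · simpa using congrFun h (Fin.last m)
  · ext i
    simp [Matrix.mulVec, dotProduct, Fin.sum_univ_castSucc, sum_smul_pow_card_pow]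
    simp [Algebra.smul_def, mul_comm]

theorem det_snoc_eq_sum {m : ℕ} (x : Fin m → K) (z : K) (q : ℕ) :
    (Matrix.of fun i j : Fin (m + 1) =>
      (Fin.snoc x z : Fin (m + 1) → K) j ^ q ^ (i : ℕ)).det =
    ∑ i : Fin (m + 1), (-1) ^ ((i : ℕ) + m) *
      (Matrix.of fun a b : Fin m => x b ^ q ^ (i.succAbove a : ℕ)).det * z ^ q ^ (i : ℕ) := by
  rw [Matrix.det_succ_column _ (Fin.last m)]
  refine sum_congr rfl fun i _ => ?_
  rw [mul_right_comm]
  congr 2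
  · refine congrArg Matrix.det (Matrix.ext fun a b => ?_)
    simp
  · simp

theorem sum_moore_eq_prod [IsDomain K] {m : ℕ} (x : Fin m → K) (hx : LinearIndependent F x) :
    ∑ i : Fin (m + 1), Polynomial.C ((-1) ^ ((i : ℕ) + m) *
      (Matrix.of fun a b : Fin m => x b ^ Fintype.card F ^ (i.succAbove a : ℕ)).det) *
        Polynomial.X ^ Fintype.card F ^ (i : ℕ) =
    Polynomial.C (Matrix.of fun a b : Fin m => x b ^ Fintype.card F ^ (a : ℕ)).det *
      ∏ c : Fin m → F, (Polynomial.X + Polynomial.C (∑ k, c k • x k)) := by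
  classical
  set q := Fintype.card F
  have hq : 1 < q := Fintype.one_lt_card
  set D := (Matrix.of fun a b : Fin m => x b ^ q ^ (a : ℕ)).det
  refine Polynomial.eq_of_degree_sub_lt_of_eval_index_eq (s := univ)
    (v := fun c : Fin m → F => ∑ k, c k • x k) ?_ ?_ ?_
  · exact fun c _ d _ h => (linearIndependent_iff_injective_fintypeLinearCombination.1 hx) (by
      simpa [Fintype.linearCombination_apply] using h)
  · have hcard : #(univ : Finset (Fin m → F)) = q ^ m := by simp [q]
    rw [Fin.sum_univ_castSucc]
    simp only [hcard]
    have h1 : (∏ c : Fin m → F, (Polynomial.X + Polynomial.C (∑ k, c k • x k))).Monic :=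
      Polynomial.monic_prod_of_monic _ _ fun c _ => Polynomial.monic_X_add_C _
    have h2 : (∏ c : Fin m → F, (Polynomial.X + Polynomial.C (∑ k, c k • x k))).degree =
        ((q ^ m : ℕ) : WithBot ℕ) := by
      rw [Polynomial.degree_prod]; simp only [Polynomial.degree_X_add_C]; simp [q]
    have h3 : Polynomial.C ((-1) ^ ((Fin.last m : ℕ) + m) *
        (Matrix.of fun a b : Fin m => x b ^ q ^ ((Fin.last m).succAbove a : ℕ)).det) *
        Polynomial.X ^ q ^ (Fin.last m : ℕ) = Polynomial.C D * Polynomial.X ^ (q ^ m) := by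
      simp [D, ← two_mul]
    rw [h3, add_sub_assoc, ← mul_sub]
    refine (Polynomial.degree_add_le _ _).trans_lt (max_lt ?_ ?_)
    · refine (Polynomial.degree_sum_le _ _).trans_lt ?_
      rw [Finset.sup_lt_iff (WithBot.bot_lt_coe _)]
      intro i _
      refine (Polynomial.degree_C_mul_X_pow_le _ _).trans_lt ?_
      exact_mod_cast Nat.pow_lt_pow_right hq (by simp)
    · rw [← Polynomial.smul_eq_C_mul]
      refine (Polynomial.degree_smul_le _ _).trans_lt ?_
      have h4 : (Polynomial.X ^ q ^ m : Polynomial K).degree = ((q ^ m : ℕ) : WithBot ℕ) :=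
        Polynomial.degree_X_pow _
      rw [← h4]
      exact Polynomial.degree_sub_lt_left (h4.trans h2.symm)
        (pow_ne_zero _ Polynomial.X_ne_zero) (by rw [h1.leadingCoeff]; simp)
  · intro c _
    have h0 := det_snoc_eq_zero x c
    rw [det_snoc_eq_sum] at h0
    simp only [Polynomial.eval_finsetSum, Polynomial.eval_mul, Polynomial.eval_C,
      Polynomial.eval_pow, Polynomial.eval_X]
    rw [h0, Polynomial.eval_prod, prod_eq_zero (i := -c) (mem_univ _) (by
      rw [Polynomial.eval_add, Polynomial.eval_X, Polynomial.eval_C]; simp), mul_zero]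

end Moore

section Dickson

theorem linearIndependent_xV {F : Type} [Field F] {n m : ℕ} (hm : m ≤ n) :
    LinearIndependent F fun j : Fin m => xV F n j := by
  have h := (MvPolynomial.linearIndependent_X (σ := Fin n) (R := F)).comp (Fin.castLE hm)
    (Fin.castLE_injective hm)
  have h2 : (fun j : Fin m => xV F n j) = X ∘ Fin.castLE hm := by
    funext j
    have : (j : ℕ) < n := j.2.trans_le hm
    simp [xV, this, Fin.castLE]
  rw [h2]
  exact h

variable {F : Type} [Field F] [Fintype F] {n : ℕ}

theorem linProd_eq_prod_smul {a : ℕ} (t : ℕ) :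
    linProd F n a t = ∏ c : Fin a → F, (xV F n t + ∑ k, c k • xV F n k) := by
  refine prod_congr rfl fun c _ => ?_
  rw [add_comm]
  simp [MvPolynomial.smul_eq_C_mul]

theorem det_moore_eq_Lm {m : ℕ} (hm : m ≤ n) :
    (Matrix.of fun a b : Fin m => xV F n b ^ Fintype.card F ^ (a : ℕ)).det = Lm F n m := by
  induction m with
  | zero => simp [Lm]
  | succ m ih =>
    have h := congrArg (Polynomial.eval (xV F n m))
      (sum_moore_eq_prod _ (linearIndependent_xV (F := F) (Nat.le_of_succ_le hm)))
    simp only [Polynomial.eval_finsetSum, Polynomial.eval_mul, Polynomial.eval_C,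
      Polynomial.eval_pow, Polynomial.eval_X, Polynomial.eval_prod, Polynomial.eval_add,
      ih (Nat.le_of_succ_le hm), ← linProd_eq_prod_smul] at h
    rw [← det_snoc_eq_sum] at h
    rw [Lm, prod_range_succ, ← Lm, ← h]
    congr 1
    ext i j : 2
    refine Fin.lastCases ?_ (fun j => ?_) j <;> simp

theorem det_mooreMat : (mooreMat F (Fintype.card F) n).det = Lm F n n := by
  rw [← det_moore_eq_Lm le_rfl]
  simp [mooreMat, xV_val]

theorem Lm_ne_zero : Lm F n n ≠ 0 := by
  rw [Lm, prod_ne_zero_iff]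
  intro a ha
  rw [linProd, prod_ne_zero_iff]
  intro c _ h
  have ha : a < n := by simpa using ha
  have h2 := Fintype.linearIndependent_iff.1 (linearIndependent_xV (F := F) (Nat.succ_le_of_lt ha))
    (Fin.snoc c 1) (by
      rw [← h, Fin.sum_univ_castSucc]
      simp [MvPolynomial.smul_eq_C_mul]) (Fin.last a)
  simp at h2

/-- The polynomial whose roots are the linear forms. -/
def formPoly (F : Type) [Field F] [Fintype F] (n : ℕ) : Polynomial (SV F n) :=
  ∏ c : Fin n → F, (Polynomial.X + Polynomial.C (∑ k, c k • (X k : SV F n)))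

theorem formPoly_eq {Q : (m : ℕ) → ℕ → SV F m} (hQ : DicksonProp F (Fintype.card F) Q) :
    formPoly F n = ∑ i ∈ range (n + 1),
      Polynomial.C ((-1) ^ (i + n) * Q n i) * Polynomial.X ^ Fintype.card F ^ i := by
  have h := sum_moore_eq_prod _ (linearIndependent_xV (F := F) (le_refl n))
  rw [det_moore_eq_Lm le_rfl] at h
  have h2 : ∀ i : Fin (n + 1), (Matrix.of fun a b : Fin n =>
      xV F n b ^ Fintype.card F ^ (i.succAbove a : ℕ)).det = Lm F n n * Q n i := by
    intro i
    rw [mul_comm, hQ n i (Nat.lt_succ_iff.1 i.2),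
      subDet_eq _ (fun a => (i.succAbove a : ℕ)) (fun b : Fin n => (b : ℕ))]
    · exact fun a b hab => Fin.strictMono_succAbove i hab
    · exact fun a b hab => hab
    · intro a
      have := (i.succAbove a).2
      simp [Fin.ext_iff.symm, Fin.succAbove_ne, Nat.lt_succ_iff.1 this]
    · simp
    · have := i.2
      rw [card_sdiff_of_subset (by simpa using this)]; simp
    · simp
  simp only [h2, mul_left_comm _ (Lm F n n), Polynomial.C_mul, mul_assoc] at h
  rw [← mul_sum] at h
  have h3 := mul_left_cancel₀ (by simpa using Lm_ne_zero) h
  simp only [formPoly, ← xV_val, ← h3]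
  rw [sum_range]
  simp [mul_assoc]

theorem dickson_self {Q : (m : ℕ) → ℕ → SV F m} (hQ : DicksonProp F (Fintype.card F) Q) :
    Q n n = 1 := by
  have h := hQ n n le_rfl
  rw [subDet_eq _ (fun a : Fin n => (a : ℕ)) (fun b : Fin n => (b : ℕ)), det_moore_eq_Lm le_rfl]
    at h
  · exact mul_right_cancel₀ Lm_ne_zero (h.trans (one_mul _).symm)
  · exact fun a b hab => hab
  · exact fun a b hab => hab
  · intro a; simp [a.2.ne, a.2.trans]
  · simp
  · rw [card_sdiff_of_subset (by simp)]; simp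
  · simp

end Dickson

/-! ### Dickson's theorem -/

section DicksonInvariants

variable {F : Type} [Field F] {n : ℕ}

theorem gAct_X (g : Matrix (Fin n) (Fin n) F) (j : Fin n) :
    gAct F n g (X j) = ∑ i, g i j • (X i : SV F n) := by
  simp [gAct, MvPolynomial.smul_eq_C_mul]

theorem gAct_sum_smul_X (g : Matrix (Fin n) (Fin n) F) (c : Fin n → F) :
    gAct F n g (∑ k, c k • X k) = ∑ k, (g.mulVec c) k • (X k : SV F n) := by
  simp_rw [map_sum, map_smul, gAct_X, smul_sum, Matrix.mulVec, dotProduct, sum_smul, smul_smul]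
  rw [sum_comm]
  simp_rw [mul_comm]

theorem sum_smul_X_injective :
    Function.Injective fun c : Fin n → F => ∑ k, c k • (X k : SV F n) := by
  have h := linearIndependent_iff_injective_fintypeLinearCombination.1
    (MvPolynomial.linearIndependent_X (σ := Fin n) (R := F))
  exact fun c d hcd => h (by simpa [Fintype.linearCombination_apply] using hcd)

theorem mulVec_bijective {g : Matrix (Fin n) (Fin n) F} (hg : IsUnit g.det) :
    Function.Bijective g.mulVec := by
  rw [← Matrix.isUnit_iff_isUnit_det] at hg
  exact ⟨Matrix.mulVec_injective_iff_isUnit.2 hg, Matrix.mulVec_surjective_iff_isUnit.2 hg⟩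

variable [Fintype F]

theorem gAct_mooreMat (g : Matrix (Fin n) (Fin n) F) :
    (mooreMat F (Fintype.card F) n).map (gAct F n g) =
      mooreMat F (Fintype.card F) n * g.map C := by
  ext1 c t
  simp only [mooreMat, Matrix.map_apply, Matrix.of_apply, map_pow, gAct_X, sum_smul_pow_card_pow,
    Matrix.mul_apply]
  exact sum_congr rfl fun i _ => by rw [MvPolynomial.smul_eq_C_mul, mul_comm]

theorem formPoly_map_gAct {g : Matrix (Fin n) (Fin n) F} (hg : IsUnit g.det) :
    (formPoly F n).map (gAct F n g : SV F n →+* SV F n) = formPoly F n := by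
  rw [formPoly, Polynomial.map_prod]
  refine Fintype.prod_bijective _ (mulVec_bijective hg) _ _ fun c => ?_
  rw [Polynomial.map_add, Polynomial.map_X, Polynomial.map_C, RingHom.coe_coe, gAct_sum_smul_X]

variable {Q : (m : ℕ) → ℕ → SV F m}

theorem coeff_formPoly (hQ : DicksonProp F (Fintype.card F) Q) {k : ℕ} (hk : k ≤ n) :
    (formPoly F n).coeff (Fintype.card F ^ k) = (-1) ^ (k + n) * Q n k := by
  rw [formPoly_eq hQ, Polynomial.finsetSum_coeff, sum_eq_single k]
  · rw [Polynomial.coeff_C_mul, Polynomial.coeff_X_pow_self, mul_one]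
  · intro i _ hi
    rw [Polynomial.coeff_C_mul, Polynomial.coeff_X_pow, if_neg, mul_zero]
    exact fun h => hi (Nat.pow_right_injective Fintype.one_lt_card h).symm
  · intro h; simp at h; omega

theorem gAct_dickson (hQ : DicksonProp F (Fintype.card F) Q) {k : ℕ} (hk : k ≤ n)
    {g : Matrix (Fin n) (Fin n) F} (hg : IsUnit g.det) : gAct F n g (Q n k) = Q n k := by
  have h := congrArg (fun P => Polynomial.coeff P (Fintype.card F ^ k)) (formPoly_map_gAct hg)
  simp only [Polynomial.coeff_map, coeff_formPoly hQ hk, RingHom.coe_coe, map_mul, map_pow,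
    map_neg, map_one] at h
  exact mul_left_cancel₀ (pow_ne_zero _ (by simp)) h

/-- The algebra generated by the Dickson invariants. -/
def dicksonAlg (Q : (m : ℕ) → ℕ → SV F m) (n : ℕ) : Subalgebra F (SV F n) :=
  Algebra.adjoin F (Set.range fun i : Fin n => Q n i)

theorem dickson_mem (hQ : DicksonProp F (Fintype.card F) Q) {k : ℕ} (hk : k ≤ n) :
    Q n k ∈ dicksonAlg Q n := by
  rcases hk.eq_or_lt with rfl | hk
  · rw [dickson_self hQ]; exact one_mem _
  · exact Algebra.subset_adjoin ⟨⟨k, hk⟩, rfl⟩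

theorem formPoly_monic : (formPoly F n).Monic :=
  Polynomial.monic_prod_of_monic _ _ fun _ _ => Polynomial.monic_X_add_C _

theorem eval_formPoly_X (j : Fin n) : (formPoly F n).eval (X j) = 0 := by
  classical
  rw [formPoly, Polynomial.eval_prod, prod_eq_zero (i := Pi.single j (-1)) (mem_univ _)]
  rw [Polynomial.eval_add, Polynomial.eval_X, Polynomial.eval_C]
  simp [Pi.single_apply]

theorem formPoly_mem_lifts (hQ : DicksonProp F (Fintype.card F) Q) :
    formPoly F n ∈ Polynomial.lifts (algebraMap (dicksonAlg Q n) (SV F n)) := by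
  rw [formPoly_eq hQ]
  refine sum_mem fun i hi => ?_
  rw [Polynomial.C_mul, map_pow, map_neg, map_one]
  have h1 : (-1 : Polynomial (SV F n)) ∈
      Polynomial.lifts (algebraMap (dicksonAlg Q n) (SV F n)) := ⟨-1, by simp⟩
  have h2 : Polynomial.C (Q n i) ∈ Polynomial.lifts (algebraMap (dicksonAlg Q n) (SV F n)) :=
    ⟨Polynomial.C ⟨Q n i, dickson_mem hQ (by simpa [Nat.lt_succ_iff] using hi)⟩, by simp⟩
  exact mul_mem (mul_mem (pow_mem (by simpa using h1) _) h2) (pow_mem (Polynomial.X_mem_lifts _) _)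

theorem isIntegral_dicksonAlg (hQ : DicksonProp F (Fintype.card F) Q) :
    Algebra.IsIntegral (dicksonAlg Q n) (SV F n) := by
  obtain ⟨P, hP, -, hm⟩ := Polynomial.lifts_and_natDegree_eq_and_monic
    (formPoly_mem_lifts (n := n) hQ) formPoly_monic
  refine ⟨fun f => ?_⟩
  induction f using MvPolynomial.induction_on with
  | C a => exact isIntegral_algebraMap (x := algebraMap F (dicksonAlg Q n) a)
  | add f g hf hg => exact hf.add hg
  | mul_X f j hf =>
    refine hf.mul ⟨P, hm, ?_⟩
    rw [← Polynomial.eval_map, hP, eval_formPoly_X]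

theorem algebraicIndependent_dickson (hQ : DicksonProp F (Fintype.card F) Q) :
    AlgebraicIndependent F fun i : Fin n => Q n i := by
  have : Algebra.IsIntegral (Algebra.adjoin F (Set.range fun i : Fin n => Q n i)) (SV F n) :=
    isIntegral_dicksonAlg hQ
  refine (Algebra.IsAlgebraic.isTranscendenceBasis_of_le_trdeg_of_finite F (fun i : Fin n => Q n i) ?_).1
  rw [MvPolynomial.trdeg_of_isDomain]
  simp

/-- Every automorphism permuting the linear forms comes from a linear substitution. -/
theorem exists_gAct_of_map_formPoly {K : Type} [Field K] [Algebra F K] (φ : SV F n →ₐ[F] K)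
    (hφ : Function.Injective φ) (σ : K →ₐ[F] K)
    (hσ : ∀ j, ((formPoly F n).map (φ : SV F n →+* K)).eval (σ (φ (X j))) = 0) :
    ∃ g : Matrix (Fin n) (Fin n) F, IsUnit g.det ∧ ∀ f, σ (φ f) = φ (gAct F n g f) := by
  have h1 : ∀ j, ∃ c : Fin n → F, σ (φ (X j)) = φ (∑ k, c k • X k) := by
    intro j
    have h := hσ j
    rw [formPoly, Polynomial.map_prod, Polynomial.eval_prod, prod_eq_zero_iff] at h
    obtain ⟨c, -, hc⟩ := h
    rw [Polynomial.map_add, Polynomial.map_X, Polynomial.map_C, Polynomial.eval_add,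
      Polynomial.eval_X, Polynomial.eval_C, RingHom.coe_coe] at hc
    refine ⟨-c, ?_⟩
    rw [eq_neg_of_add_eq_zero_left hc, ← map_neg]
    simp
  choose c hc using h1
  have h2 : ∀ f, σ (φ f) = φ (gAct F n (Matrix.of fun i j => c j i) f) := by
    have : σ.comp φ = φ.comp (gAct F n (Matrix.of fun i j => c j i)) := by
      refine MvPolynomial.algHom_ext fun j => ?_
      simp only [AlgHom.comp_apply, hc, gAct_X, Matrix.of_apply]
    exact fun f => DFunLike.congr_fun this f
  refine ⟨_, ?_, h2⟩
  rw [isUnit_iff_ne_zero]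
  intro h0
  obtain ⟨v, hv, hv0⟩ := Matrix.exists_mulVec_eq_zero_iff.2 h0
  refine hv (sum_smul_X_injective (hφ (σ.toRingHom.injective ?_)))
  change σ (φ (∑ k, v k • X k)) = σ (φ (∑ k, (0 : Fin n → F) k • X k))
  rw [h2, gAct_sum_smul_X, hv0]
  simp

theorem mem_range_of_mem_invS {k K : Type} [Field k] [Field K] [Algebra F k] [Algebra F K]
    [Algebra k K] [IsScalarTower F k K] [Algebra (SV F n) K] [IsScalarTower F (SV F n) K]
    [IsFractionRing (SV F n) K] {P : Polynomial k}
    (hP : P.map (algebraMap k K) = (formPoly F n).map (algebraMap (SV F n) K))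
    {f : SV F n} (hf : f ∈ invS F n (GLset F n)) :
    algebraMap (SV F n) K f ∈ Set.range (algebraMap k K) := by
  have hinj : Function.Injective (algebraMap (SV F n) K) := IsFractionRing.injective _ _
  have hprod : P.map (algebraMap k K) = ∏ c : Fin n → F,
      (Polynomial.X - Polynomial.C (algebraMap (SV F n) K (∑ i, (-c) i • X i))) := by
    rw [hP, formPoly, Polynomial.map_prod]
    refine prod_congr rfl fun c _ => ?_
    rw [Polynomial.map_add, Polynomial.map_X, Polynomial.map_C, sub_eq_add_neg, ← Polynomial.C_neg,
      ← map_neg]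
    simp
  have hsep : P.Separable := by
    rw [← Polynomial.separable_map (algebraMap k K), hprod, Polynomial.separable_prod_X_sub_C_iff]
    exact fun c d hcd => neg_injective (sum_smul_X_injective (hinj hcd))
  have hroot : ∀ j, (P.map (algebraMap k K)).eval (algebraMap (SV F n) K (X j)) = 0 := by
    intro j
    rw [hP, Polynomial.eval_map_algebraMap, Polynomial.aeval_algebraMap_apply,
      Polynomial.coe_aeval_eq_eval, eval_formPoly_X, map_zero]
  have hP0 : P ≠ 0 := hsep.ne_zero
  have hsplit : P.IsSplittingField k K := by
    rw [isSplittingField_iff_intermediateField]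
    refine ⟨?_, ?_⟩
    · rw [hprod]
      exact Polynomial.Splits.prod fun c _ => Polynomial.Splits.X_sub_C _
    · rw [eq_top_iff]
      intro z _
      have hmem : ∀ a : SV F n, algebraMap (SV F n) K a ∈
          IntermediateField.adjoin k (P.rootSet K) := by
        intro a
        induction a using MvPolynomial.induction_on with
        | C a =>
          rw [← MvPolynomial.algebraMap_eq, ← IsScalarTower.algebraMap_apply,
            IsScalarTower.algebraMap_apply F k K]
          exact IntermediateField.algebraMap_mem _ _
        | add a b ha hb => rw [map_add]; exact add_mem ha hb
        | mul_X a j ha =>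
          rw [map_mul]
          refine mul_mem ha (IntermediateField.subset_adjoin _ _ ?_)
          rw [Polynomial.mem_rootSet_of_ne hP0, ← Polynomial.eval_map_algebraMap, hroot]
      obtain ⟨a, b, -, rfl⟩ := IsFractionRing.div_surjective (A := SV F n) z
      exact div_mem (hmem a) (hmem b)
  have : IsGalois k K := IsGalois.of_separable_splitting_field hsep
  have : FiniteDimensional k K := Polynomial.IsSplittingField.finiteDimensional K P
  rw [IsGalois.mem_range_algebraMap_iff_fixed]
  intro σ
  obtain ⟨g, hg, h⟩ := exists_gAct_of_map_formPoly (IsScalarTower.toAlgHom F (SV F n) K) hinj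
    (AlgHom.restrictScalars F (σ : K →ₐ[k] K)) (fun j => by
      have h := congrArg σ (hroot j)
      rw [Polynomial.eval_map_algebraMap, map_zero, ← Polynomial.aeval_algHom_apply,
        ← Polynomial.eval_map_algebraMap, hP] at h
      exact h)
  have h2 := h f
  rw [hf g hg] at h2
  exact h2

open IntermediateField.algebraAdjoinAdjoin in
/-- **Dickson's theorem.** -/
theorem invS_GLset (hQ : DicksonProp F (Fintype.card F) Q) :
    invS F n (GLset F n) = dicksonAlg Q n := by
  refine le_antisymm (fun f hf => ?_) ?_
  · let K := FractionRing (SV F n)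
    let φ : SV F n →ₐ[F] K := IsScalarTower.toAlgHom F (SV F n) K
    have hinj : Function.Injective φ := IsFractionRing.injective (SV F n) K
    let S : Set K := Set.range (φ ∘ fun i : Fin n => Q n i)
    have hind : AlgebraicIndependent F (φ ∘ fun i : Fin n => Q n i) :=
      (algebraicIndependent_dickson hQ).map' hinj
    have hIC : IsIntegrallyClosed (Algebra.adjoin F S) :=
      IsIntegrallyClosed.of_equiv hind.aevalEquiv.toRingEquiv
    have hmap : (dicksonAlg Q n).map φ = Algebra.adjoin F S := by
      rw [dicksonAlg, AlgHom.map_adjoin, ← Set.range_comp]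
    have hlift : ∀ a ∈ dicksonAlg Q n, φ a ∈ Algebra.adjoin F S := fun a ha => by
      rw [← hmap]; exact ⟨a, ha, rfl⟩
    obtain ⟨P, hP, -, hm⟩ := Polynomial.lifts_and_natDegree_eq_and_monic
      (formPoly_mem_lifts (n := n) hQ) formPoly_monic
    let ψ : dicksonAlg Q n →+* Algebra.adjoin F S :=
      ((φ.comp (dicksonAlg Q n).val).codRestrict (Algebra.adjoin F S)
        fun a => hlift _ a.2).toRingHom
    obtain ⟨y, hy⟩ := mem_range_of_mem_invS (k := IntermediateField.adjoin F S) (K := K)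
      (P := (P.map ψ).map (algebraMap _ _)) (by
        rw [← hP, Polynomial.map_map, Polynomial.map_map, Polynomial.map_map]
        rfl) hf
    have hint : IsIntegral (Algebra.adjoin F S) y := by
      obtain ⟨p, hpm, hp⟩ := (isIntegral_dicksonAlg (n := n) hQ).isIntegral f
      refine ⟨p.map ψ, hpm.map _, ?_⟩
      apply (algebraMap (IntermediateField.adjoin F S) K).injective
      rw [Polynomial.eval₂_map, Polynomial.hom_eval₂, hy, map_zero]
      have := congrArg φ hp
      rw [map_zero] at this
      rw [← this]
      exact (Polynomial.hom_eval₂ p _ (φ : SV F n →+* K) f).symm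
    obtain ⟨z, hz⟩ := (IsIntegrallyClosed.isIntegral_iff).1 hint
    have hz2 : φ f ∈ (dicksonAlg Q n).map φ := by
      rw [hmap]
      have : (z : K) = φ f := by rw [← IntermediateField.algebraAdjoinAdjoin.coe_algebraMap, hz]; exact hy
      rw [← this]; exact z.2
    obtain ⟨a, ha, hfa⟩ := hz2
    rw [← hinj hfa]; exact ha
  · refine Algebra.adjoin_le ?_
    rintro _ ⟨i, rfl⟩ g hg
    exact gAct_dickson hQ i.2.le hg

end DicksonInvariants

/-! ### Coefficients of the transformed invariants -/

section Coefficients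

variable {F : Type} [Field F] {n : ℕ} {T : Type} [CommRing T] [Algebra F T]

theorem linSub_one (f : T ⊗[F] LV F n) : linSub (1 : Matrix (Fin n) (Fin n) T) f = f := by
  have : linSub (1 : Matrix (Fin n) (Fin n) T) = AlgHom.id T (T ⊗[F] LV F n) := by
    apply AlgHom.restrictScalars_injective F
    refine tensor_algHom_ext (fun t => ?_) fun j => ?_
    · simp [linSub_tmul_one]
    · simp [linSub_tmul_ι, oneForm_algebraMap]
  rw [this]
  rfl

theorem repr_linSub (g : Matrix (Fin n) (Fin n) T) (f : T ⊗[F] LV F n) (R : Finset (Fin n)) :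
    (tBasis F n T).repr (linSub g f) R = ∑ S, minor g R S * (tBasis F n T).repr f S := by
  conv_lhs => rw [← (tBasis F n T).sum_repr f]
  simp_rw [map_sum, map_smul, linSub_tBasis, Finsupp.finsetSum_apply, Finsupp.smul_apply,
    map_sum, map_smul, Module.Basis.repr_self, Finsupp.finsetSum_apply, Finsupp.smul_apply]
  refine sum_congr rfl fun S _ => ?_
  rw [sum_eq_single R]
  · simp [mul_comm]
  · intro R' _ h; simp [h]
  · simp

theorem repr_coeffMap (s : T →ₐ[F] T) (f : T ⊗[F] LV F n) (R : Finset (Fin n)) :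
    (tBasis F n T).repr (coeffMap s f) R = s ((tBasis F n T).repr f R) := by
  induction f using TensorProduct.induction_on with
  | zero => simp
  | tmul t w => simp [tBasis_repr_tmul]
  | add f g hf hg => simp [hf, hg]

theorem minor_congr {g h : Matrix (Fin n) (Fin n) T} {R : Finset (Fin n)}
    (hgh : ∀ a ∈ R, g a = h a) (S : Finset (Fin n)) : minor g R S = minor h R S := by
  by_cases hc : R.card = S.card
  · rw [minor_eq g hc rfl, minor_eq h hc rfl]
    congr 1
    ext i j
    exact congrFun (hgh _ (orderEmbOfFin_mem R hc i)) _
  · rw [minor_of_card_ne _ hc, minor_of_card_ne _ hc]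

theorem minor_updateRow_add (g : Matrix (Fin n) (Fin n) T) {R : Finset (Fin n)} {k : Fin n}
    (hk : k ∈ R) (S : Finset (Fin n)) (u v : Fin n → T) :
    minor (g.updateRow k (u + v)) R S =
      minor (g.updateRow k u) R S + minor (g.updateRow k v) R S := by
  by_cases hc : R.card = S.card
  · obtain ⟨j, hj⟩ : ∃ j, R.orderEmbOfFin hc j = k := by
      have : k ∈ Set.range (R.orderEmbOfFin hc) := by rw [range_orderEmbOfFin]; exact hk
      exact this
    have h (w : Fin n → T) : minor (g.updateRow k w) R S =
        ((g.submatrix (R.orderEmbOfFin hc) (S.orderEmbOfFin rfl)).updateRow j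
          (w ∘ S.orderEmbOfFin rfl)).det := by
      rw [minor_eq _ hc rfl]
      congr 1
      ext a b
      simp [Matrix.updateRow_apply, ← hj]
    rw [h, h, h, ← Matrix.det_updateRow_add]
    rfl
  · simp only [minor_of_card_ne _ hc, add_zero]

theorem minor_eq_zero_of_column (g : Matrix (Fin n) (Fin n) T) {R S : Finset (Fin n)} {i : Fin n}
    (hi : i ∈ S) (h : ∀ a, g a i = 0) : minor g R S = 0 := by
  by_cases hc : R.card = S.card
  · obtain ⟨j, hj⟩ : ∃ j, S.orderEmbOfFin rfl j = i := by
      have : i ∈ Set.range (S.orderEmbOfFin rfl) := by rw [range_orderEmbOfFin]; exact hi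
      exact this
    rw [minor_eq _ hc rfl]
    exact Matrix.det_eq_zero_of_column_eq_zero j fun a => by simp [hj, h]
  · exact minor_of_card_ne _ hc

/-- An element fixed by the transvection `y_k ↦ y_k + y_i` has no coefficient at the sets
containing `k` but not `i`. -/
theorem repr_eq_zero_of_transvection {f : T ⊗[F] LV F n} {i k : Fin n} (hik : i ≠ k)
    (hf : linSub (Matrix.transvection i k (1 : T)) f = f) {S : Finset (Fin n)} (hi : i ∉ S)
    (hk : k ∈ S) : (tBasis F n T).repr f S = 0 := by
  let e (a : Fin n) : Fin n → T := (1 : Matrix (Fin n) (Fin n) T) a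
  let M : Matrix (Fin n) (Fin n) T := Matrix.updateRow 1 k (e i)
  have h1 (S' : Finset (Fin n)) : minor (M * Matrix.transvection i k 1) S S' =
      minor M S S' + minor 1 S S' := by
    have h2 : (1 : Matrix (Fin n) (Fin n) T) = Matrix.updateRow 1 k (e k) := by
      rw [show e k = (1 : Matrix (Fin n) (Fin n) T) k from rfl, Matrix.updateRow_eq_self]
    conv_rhs => rw [h2]
    rw [← minor_updateRow_add _ hk]
    refine minor_congr (fun a ha => ?_) S'
    have hai : a ≠ i := fun h => hi (h ▸ ha)
    ext b
    rw [Matrix.transvection, mul_add, mul_one, Matrix.add_apply]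
    by_cases hak : a = k
    · subst hak
      by_cases hb : b = a
      · subst hb; simp [M, e]
      · simp [M, e, hb, Ne.symm hb]
    · by_cases hb : b = k
      · subst hb; simp [M, e, hak, hai]
      · simp [M, e, hb, hak]
  have h3 : linSub (M * Matrix.transvection i k 1) f = linSub M f := by
    rw [← linSub_linSub, hf]
  have h4 := repr_linSub (M * Matrix.transvection i k 1) f S
  simp only [h1, add_mul, sum_add_distrib, ← repr_linSub, linSub_one, h3] at h4
  exact left_eq_add.1 h4

theorem linSub_smul_one (a : T) (S : Finset (Fin n)) :
    linSub (a • (1 : Matrix (Fin n) (Fin n) T)) (tBasis F n T S) = a ^ S.card • tBasis F n T S := by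
  have hminor (R : Finset (Fin n)) :
      minor (a • (1 : Matrix (Fin n) (Fin n) T)) R S = a ^ S.card * minor 1 R S := by
    by_cases h : R.card = S.card
    · rw [minor_eq _ h rfl, minor_eq _ h rfl]
      refine (Matrix.det_smul (Matrix.submatrix 1 (R.orderEmbOfFin h) (S.orderEmbOfFin rfl)) a).trans ?_
      rw [Fintype.card_fin]
    · rw [minor_of_card_ne _ h, minor_of_card_ne _ h, mul_zero]
  simp_rw [linSub_tBasis, hminor, mul_smul]
  rw [← smul_sum, ← linSub_tBasis, linSub_one]

end Coefficients

/-! ### Divisibility by linear forms -/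

section Divisibility

variable {F : Type} [Field F] {n : ℕ}

/-- The substitution `x_i ↦ 0`. -/
def setZero (i : Fin n) : SV F n →ₐ[F] SV F n :=
  aeval (Function.update X i 0)

theorem setZero_X_self (i : Fin n) : setZero i (X i : SV F n) = 0 := by simp [setZero]

theorem setZero_X_of_ne {i j : Fin n} (h : j ≠ i) : setZero i (X j : SV F n) = X j := by
  simp [setZero, h]

theorem X_dvd_sub_setZero (i : Fin n) (f : SV F n) : X i ∣ f - setZero i f := by
  induction f using MvPolynomial.induction_on with
  | C a => simp [setZero]
  | add f g hf hg => rw [map_add, add_sub_add_comm]; exact dvd_add hf hg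
  | mul_X f j hf =>
    rw [map_mul]
    by_cases h : j = i
    · subst h; simp [setZero_X_self]
    · rw [setZero_X_of_ne h, ← sub_mul]; exact hf.mul_right _

theorem X_dvd_iff_setZero {i : Fin n} {f : SV F n} : X i ∣ f ↔ setZero i f = 0 := by
  constructor
  · rintro ⟨g, rfl⟩; rw [map_mul, setZero_X_self, zero_mul]
  · intro h; simpa [h] using X_dvd_sub_setZero i f

theorem setZero_gAct {i : Fin n} {g : Matrix (Fin n) (Fin n) F}
    (hg : ∀ a b, a ≠ i → g a b = (1 : Matrix (Fin n) (Fin n) F) a b) (f : SV F n)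
    : setZero i (gAct F n g f) = setZero i f := by
  have : (setZero i).comp (gAct F n g) = (setZero i).comp (gAct F n 1) := by
    refine MvPolynomial.algHom_ext fun j => ?_
    simp only [AlgHom.comp_apply, gAct_X, map_sum, map_smul]
    refine sum_congr rfl fun a _ => ?_
    by_cases ha : a = i
    · subst ha; simp [setZero_X_self]
    · rw [hg a j ha]
  have h1 : gAct F n 1 = AlgHom.id F (SV F n) :=
    MvPolynomial.algHom_ext fun j => by simp [gAct_X, Matrix.one_apply]
  rw [h1] at this
  exact DFunLike.congr_fun this f

variable [Fintype F]

/-- A polynomial invariant under the dilations of `x_i` and divisible by `x_i` is divisible by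
`x_i ^ (q - 1)`. -/
theorem X_pow_dvd_of_dilation {i : Fin n} {c : SV F n}
    (hc : ∀ u : Fˣ, gAct F n (Matrix.diagonal (Function.update 1 i (u : F))) c = c)
    (hi : X i ∣ c) : X i ^ (Fintype.card F - 1) ∣ c := by
  by_cases h0 : c = 0
  · rw [h0]; exact dvd_zero _
  have hfin : FiniteMultiplicity (X i) c := .of_not_isUnit MvPolynomial.X_prime.not_isUnit h0
  obtain ⟨d, hd, hnd⟩ := hfin.exists_eq_pow_mul_and_not_dvd
  set a := multiplicity (X i) c
  have ha : a ≠ 0 := fun h => hnd (by rw [h, pow_zero, one_mul] at hd; rwa [← hd])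
  have hpow (u : Fˣ) : u ^ a = 1 := by
    have h1 := hc u
    set g := Matrix.diagonal (Function.update (1 : Fin n → F) i (u : F)) with hg
    have hX : gAct F n g (X i) = (u : F) • (X i : SV F n) := by
      rw [gAct_X, sum_eq_single i] <;> simp +contextual [hg]
    rw [hd, map_mul, map_pow, hX, smul_pow, smul_mul_assoc, ← mul_smul_comm] at h1
    have h2 := congrArg (setZero i) (mul_left_cancel₀ (pow_ne_zero _ (MvPolynomial.X_ne_zero i)) h1)
    rw [map_smul, setZero_gAct] at h2
    · have h3 : setZero i d ≠ 0 := fun h => hnd (X_dvd_iff_setZero.2 h)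
      have h4 : ((u : F) ^ a - 1) • setZero i d = 0 := by rw [sub_smul, h2, one_smul, sub_self]
      ext
      simpa [sub_eq_zero] using (smul_eq_zero.1 h4).resolve_right h3
    · intro a b hab
      rw [hg, Matrix.diagonal_apply, Matrix.one_apply, Function.update_of_ne hab, Pi.one_apply]
  have h5 : Fintype.card F - 1 ∣ a := (FiniteField.forall_pow_eq_one_iff F a).1 hpow
  rw [hd]
  exact (pow_dvd_pow _ (Nat.le_of_dvd (Nat.pos_of_ne_zero ha) h5)).mul_right _

theorem linForm_pow_dvd {c : SV F n} (hc : c ∈ invS F n (GLset F n)) (hX : ∀ i, X i ∣ c)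
    {v : Fin n → F} (hv : v ≠ 0) : (∑ k, v k • X k) ^ (Fintype.card F - 1) ∣ c := by
  obtain ⟨j, hj⟩ := Function.ne_iff.1 hv
  have h1 : X j ^ (Fintype.card F - 1) ∣ c := by
    refine X_pow_dvd_of_dilation (fun u => hc _ ?_) (hX j)
    rw [GLset, Set.mem_ofPred_eq, Matrix.det_diagonal, prod_update_of_mem (mem_univ _)]
    simp
  let g : Matrix (Fin n) (Fin n) F := Matrix.updateCol 1 j v
  have hg : g ∈ GLset F n := by
    rw [GLset, Set.mem_ofPred_eq, ← Matrix.cramer_apply, Matrix.cramer_one]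
    simpa using hj
  have h2 : gAct F n g (X j) = ∑ k, v k • X k := by simp [gAct_X, g]
  rw [← h2, ← map_pow, ← hc g hg]
  exact map_dvd _ h1

end Divisibility

section LinearForms

variable {F : Type} [Field F] {n : ℕ}

theorem irreducible_linForm {v : Fin n → F} (hv : v ≠ 0) :
    Irreducible (∑ k, v k • X k : SV F n) := by
  obtain ⟨j, hj⟩ := Function.ne_iff.1 hv
  have h := MvPolynomial.irreducible_sumSMulX (Finsupp.equivFunOnFinite.symm v) ⟨j, by simpa using hj⟩
    fun r hr => isUnit_of_dvd_unit (hr j) (Ne.isUnit (by simpa using hj))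
  rwa [MvPolynomial.sumSMulX, Finsupp.linearCombination_apply,
    Finsupp.sum_fintype _ _ (by simp)] at h

theorem isRelPrime_linForm {v w : Fin n → F} (hv : v ≠ 0) (hw : w ≠ 0) (h : ∀ u : F, w ≠ u • v) :
    IsRelPrime (∑ k, v k • X k : SV F n) (∑ k, w k • X k) := by
  rw [(irreducible_linForm hv).isRelPrime_iff_not_dvd]
  intro hdvd
  obtain ⟨e, he⟩ := (irreducible_linForm hv).associated_of_dvd (irreducible_linForm hw) hdvd
  obtain ⟨u, -, hu⟩ := MvPolynomial.isUnit_iff_eq_C_of_isReduced.1 e.isUnit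
  refine h u (sum_smul_X_injective ?_)
  dsimp only
  rw [← he, hu, mul_comm, ← MvPolynomial.smul_eq_C_mul, smul_sum]
  simp [smul_smul]

/-- The coefficient vector of `c_1 x_1 + ⋯ + c_a x_a + x_{a+1}`. -/
def leadVec (F : Type) [Field F] (s : Σ a : ℕ, (Fin a → F)) (k : ℕ) : F :=
  if h : k < s.1 then s.2 ⟨k, h⟩ else if k = s.1 then 1 else 0

theorem leadVec_fin {a : ℕ} (c : Fin a → F) (k : Fin a) : leadVec F ⟨a, c⟩ k = c k := by
  simp [leadVec]

theorem leadVec_self (s : Σ a : ℕ, (Fin a → F)) : leadVec F s s.1 = 1 := by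
  simp [leadVec]

theorem leadVec_of_lt (s : Σ a : ℕ, (Fin a → F)) {k : ℕ} (h : s.1 < k) : leadVec F s k = 0 := by
  simp [leadVec, h.not_gt, h.ne']

theorem sum_leadVec {a : ℕ} (c : Fin a → F) (ha : a < n) :
    xV F n a + ∑ k : Fin a, c k • xV F n k = ∑ k : Fin n, leadVec F ⟨a, c⟩ k • X k := by
  have h1 : ∑ k : Fin a, c k • xV F n k = ∑ k ∈ range a, leadVec F ⟨a, c⟩ k • xV F n k := by
    rw [← Fin.sum_univ_eq_sum_range fun k => leadVec F ⟨a, c⟩ k • xV F n k]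
    simp only [leadVec_fin]
  have h2 : xV F n a = leadVec F ⟨a, c⟩ a • xV F n a := by
    rw [leadVec_self ⟨a, c⟩, one_smul]
  have h3 : ∑ k : Fin n, leadVec F ⟨a, c⟩ k • (X k : SV F n) =
      ∑ k ∈ range n, leadVec F ⟨a, c⟩ k • xV F n k := by
    rw [← Fin.sum_univ_eq_sum_range fun k => leadVec F ⟨a, c⟩ k • xV F n k]
    simp only [xV_val]
  rw [h1, h2, add_comm, ← sum_range_succ, h3]
  refine sum_subset (range_subset_range.2 ha) fun k _ hk => ?_
  rw [leadVec_of_lt, zero_smul]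
  simpa using hk

theorem leadVec_injective {s t : Σ a : ℕ, (Fin a → F)} (hs : s.1 < n) (ht : t.1 < n) {u : F}
    (h : ∀ k < n, leadVec F t k = u * leadVec F s k) : s = t := by
  obtain ⟨a, c⟩ := s
  obtain ⟨b, d⟩ := t
  dsimp only at hs ht
  have hb := h b ht
  rw [leadVec_self ⟨b, d⟩] at hb
  have ha := h a hs
  rw [leadVec_self ⟨a, c⟩, mul_one] at ha
  rcases lt_trichotomy a b with hab | rfl | hab
  · rw [leadVec_of_lt _ hab, mul_zero] at hb
    exact absurd hb one_ne_zero
  · rw [leadVec_self ⟨a, d⟩] at ha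
    congr 1
    ext k
    have := h k (k.2.trans hs)
    rwa [← ha, one_mul, leadVec_fin, leadVec_fin, eq_comm] at this
  · rw [leadVec_of_lt _ hab] at ha
    rw [← ha, zero_mul] at hb
    exact absurd hb one_ne_zero

variable [Fintype F]

theorem Lm_eq_prod_leadVec :
    Lm F n n = ∏ s ∈ (range n).sigma fun a => (univ : Finset (Fin a → F)),
      ∑ k : Fin n, leadVec F s k • X k := by
  rw [Lm, prod_sigma]
  refine prod_congr rfl fun a ha => ?_
  rw [linProd_eq_prod_smul]
  exact prod_congr rfl fun c _ => sum_leadVec c (mem_range.1 ha)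

/-- An invariant divisible by all the variables is divisible by `L_n ^ (q - 1)`. -/
theorem Lm_pow_dvd {c : SV F n} (hc : c ∈ invS F n (GLset F n)) (hX : ∀ i, X i ∣ c) :
    Lm F n n ^ (Fintype.card F - 1) ∣ c := by
  have hne (s : Σ a : ℕ, (Fin a → F)) (hs : s.1 < n) :
      (fun k : Fin n => leadVec F s k) ≠ 0 := fun h => by
    have := congrFun h ⟨s.1, hs⟩
    rw [leadVec_self] at this
    exact one_ne_zero this
  rw [Lm_eq_prod_leadVec, ← prod_pow]
  refine prod_dvd_of_isRelPrime (fun s hs t ht hst => ?_) fun s hs => ?_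
  · simp only [coe_sigma, Set.mem_sigma_iff, mem_coe, mem_range] at hs ht
    refine (isRelPrime_linForm (hne s hs.1) (hne t ht.1) fun u hu => hst ?_).pow
    exact leadVec_injective hs.1 ht.1 fun k hk => congrFun hu ⟨k, hk⟩
  · exact linForm_pow_dvd hc hX (hne s (by simpa using hs))

end LinearForms

section Coefficients

variable {F : Type} [Field F] [Fintype F] {n : ℕ}

theorem coeffMap_linSub_mooreMat (g : Matrix (Fin n) (Fin n) F) (f : SL F n) :
    coeffMap (gAct F n g) (linSub (mooreMat F (Fintype.card F) n) f) =
      linSub (mooreMat F (Fintype.card F) n) (tAct F n g f) := by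
  rw [coeffMap_linSub, gAct_mooreMat, ← linSub_linSub, ← tAct_eq]

theorem repr_linSub_mem_invS {f : SL F n} (hf : f ∈ invSL F n (GLset F n)) (B : Finset (Fin n)) :
    (tBasis F n (SV F n)).repr (linSub (mooreMat F (Fintype.card F) n) f) B ∈
      invS F n (GLset F n) := fun g hg => by
  rw [← repr_coeffMap, coeffMap_linSub_mooreMat, hf g hg]

theorem X_dvd_repr_linSub {f : SL F n} (hf : f ∈ invSL F n (GLset F n)) {B : Finset (Fin n)}
    (hB : B.Nonempty) (i : Fin n) :
    X i ∣ (tBasis F n (SV F n)).repr (linSub (mooreMat F (Fintype.card F) n) f) B := by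
  have hfix (k : Fin n) (hik : i ≠ k) :
      linSub (Matrix.transvection i k (1 : SV F n)) (coeffMap (setZero i) f) =
        coeffMap (setZero i) f := by
    let g : Matrix (Fin n) (Fin n) F := Matrix.transvection i k 1
    have hmap : (g.map C).map (setZero i) = Matrix.transvection i k (1 : SV F n) := by
      ext1 a b
      simp only [g, Matrix.transvection, Matrix.map_apply, Matrix.add_apply, Matrix.one_apply,
        Matrix.single_apply]
      split_ifs <;> simp
    have hcomp : coeffMap (setZero i) (coeffMap (gAct F n g) f) = coeffMap (setZero i) f := by
      refine (tBasis F n (SV F n)).ext_elem fun S => ?_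
      rw [repr_coeffMap, repr_coeffMap, repr_coeffMap, setZero_gAct]
      intro a b hai
      simp [g, Matrix.transvection, Ne.symm hai]
    have hg : g ∈ GLset F n := by
      rw [GLset, Set.mem_ofPred_eq, Matrix.det_transvection_of_ne _ _ hik]
      exact isUnit_one
    have h := congrArg (coeffMap (setZero i)) (hf g hg)
    rwa [tAct_eq, coeffMap_linSub, hmap, hcomp] at h
  rw [X_dvd_iff_setZero, ← repr_coeffMap, coeffMap_linSub, repr_linSub]
  refine sum_eq_zero fun S _ => ?_
  by_cases hi : i ∈ S
  · rw [minor_eq_zero_of_column _ hi, zero_mul]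
    intro a
    simp [mooreMat, setZero_X_self, Fintype.card_ne_zero]
  · rcases S.eq_empty_or_nonempty with rfl | ⟨k, hk⟩
    · rw [minor_of_card_ne _ (by simpa using hB.ne_empty), zero_mul]
    · have hik : i ≠ k := fun h => hi (h ▸ hk)
      rw [repr_eq_zero_of_transvection hik (hfix k hik) hi hk, mul_zero]

theorem gAct_Lm (g : Matrix (Fin n) (Fin n) F) :
    gAct F n g (Lm F n n) = C g.det * Lm F n n := by
  have h := congrArg Matrix.det (gAct_mooreMat g)
  rw [← AlgHom.mapMatrix_apply, ← AlgHom.map_det, Matrix.det_mul, det_mooreMat,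
    ← RingHom.mapMatrix_apply, ← RingHom.map_det] at h
  rw [h, mul_comm]

theorem Lm_pow_mem_invS : Lm F n n ^ (Fintype.card F - 1) ∈ invS F n (GLset F n) := fun g hg => by
  rw [map_pow, gAct_Lm, mul_pow, ← C_pow, FiniteField.pow_card_sub_one_eq_one _ (IsUnit.ne_zero hg),
    C_1, one_mul]

theorem exists_repr_linSub_eq {f : SL F n} (hf : f ∈ invSL F n (GLset F n)) {B : Finset (Fin n)}
    (hB : B.Nonempty) : ∃ d ∈ invS F n (GLset F n),
      (tBasis F n (SV F n)).repr (linSub (mooreMat F (Fintype.card F) n) f) B =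
        Lm F n n ^ (Fintype.card F - 1) * d := by
  obtain ⟨d, hd⟩ := Lm_pow_dvd (repr_linSub_mem_invS hf B) (X_dvd_repr_linSub hf hB)
  refine ⟨d, fun g hg => ?_, hd⟩
  have h := repr_linSub_mem_invS hf B g hg
  rw [hd, map_mul, Lm_pow_mem_invS g hg] at h
  exact mul_left_cancel₀ (pow_ne_zero _ Lm_ne_zero) h

theorem linSub_mooreMat_injective :
    Function.Injective (linSub (F := F) (mooreMat F (Fintype.card F) n)) := by
  rw [injective_iff_map_eq_zero]
  intro f hf
  have h := congrArg (linSub (mooreMat F (Fintype.card F) n).adjugate) hf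
  rw [linSub_linSub, Matrix.adjugate_mul, det_mooreMat, map_zero,
    ← (tBasis F n (SV F n)).sum_repr f, map_sum] at h
  refine (tBasis F n (SV F n)).ext_elem fun S => ?_
  have h2 := congrArg (fun x => (tBasis F n (SV F n)).repr x S) h
  simp only [map_smul, linSub_smul_one, smul_smul, (tBasis F n (SV F n)).repr_sum_self, map_zero,
    Finsupp.zero_apply] at h2 ⊢
  exact (mul_eq_zero.1 h2).resolve_right (pow_ne_zero _ Lm_ne_zero)

end Coefficients

/-! ### Mui's theorem -/

section Mui

variable {F : Type} [Field F] {n : ℕ}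

theorem powerset_range_filter_nonempty :
    (range n).powerset.filter (fun B => B.Nonempty) =
      ((univ : Finset (Finset (Fin n))).filter fun B => B.Nonempty).map
        (mapEmbedding Fin.valEmbedding).toEmbedding := by
  ext B
  simp only [mem_filter, mem_powerset, mem_map, mem_univ, true_and]
  constructor
  · rintro ⟨hB, hne⟩
    rw [range_eq_map_univ, subset_map_iff] at hB
    obtain ⟨S, -, rfl⟩ := hB
    exact ⟨S, by simpa using hne, rfl⟩
  · rintro ⟨S, hS, rfl⟩
    refine ⟨?_, hS.map⟩
    rw [range_eq_map_univ]
    exact map_subset_map.2 (subset_univ S)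

theorem tmul_one_eq_smul_tBasis (c : SV F n) :
    c ⊗ₜ[F] (1 : LV F n) = c • tBasis F n (SV F n) ∅ := by
  rw [tBasis_apply, ← yProd_map, TensorProduct.smul_tmul']
  simp [yProd]

theorem shuffleSign_mul_self (S : Finset ℕ) : shuffleSign F S * shuffleSign F S = 1 := by
  rw [shuffleSign, ← mul_pow, neg_one_mul, neg_neg, one_pow]

variable [Fintype F]

theorem linSub_sum_muiM (c₀ : SV F n) (c : Finset ℕ → SV F n) :
    linSub (mooreMat F (Fintype.card F) n)
      (c₀ ⊗ₜ[F] 1 + ∑ B ∈ (range n).powerset.filter (fun B => B.Nonempty), (c B ⊗ₜ[F] 1) *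
        (MuiM F (Fintype.card F) n n B * ((Lm F n n ^ (Fintype.card F - 2)) ⊗ₜ[F] 1))) =
    ∑ B : Finset (Fin n), (if B.Nonempty then
      shuffleSign F (B.map Fin.valEmbedding) •
        (Lm F n n ^ (Fintype.card F - 1) * c (B.map Fin.valEmbedding)) else c₀) •
          tBasis F n (SV F n) B := by
  have hq : Fintype.card F - 1 = Fintype.card F - 2 + 1 := by
    have := Fintype.one_lt_card (α := F)
    omega
  have h0 (a : SV F n) : a ⊗ₜ[F] (1 : LV F n) = algebraMap (SV F n) (SL F n) a := rfl
  have h1 (a b : SV F n) (M : SL F n) : (a ⊗ₜ[F] 1) * (M * (b ⊗ₜ[F] 1)) = (a * b) • M := by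
    rw [h0, h0, ← Algebra.commutes b M, ← Algebra.smul_def, ← Algebra.smul_def, smul_smul]
  have h2 : (univ : Finset (Finset (Fin n))).filter (fun B => ¬ B.Nonempty) = {∅} := by
    ext B; simp
  simp_rw [h1]
  rw [tmul_one_eq_smul_tBasis, map_add, map_smul, linSub_tBasis_empty, map_sum,
    powerset_range_filter_nonempty, sum_map,
    ← sum_filter_add_sum_filter_not univ (fun B : Finset (Fin n) => B.Nonempty), h2, sum_singleton,
    if_neg Finset.not_nonempty_empty, add_comm]
  congr 1
  refine sum_congr rfl fun B hB => ?_
  rw [if_pos (mem_filter.1 hB).2, map_smul]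
  change _ • linSub _ (MuiM F _ n n (B.map Fin.valEmbedding)) = _
  rw [linSub_muiM, det_mooreMat, smul_smul, hq, pow_succ, Algebra.smul_def (shuffleSign F _)]
  congr 1
  change c (B.map Fin.valEmbedding) * _ * _ = _
  ring

theorem mem_invSL_of_eq_sum_muiM {c₀ : SV F n} {c : Finset ℕ → SV F n}
    (h₀ : c₀ ∈ invS F n (GLset F n))
    (hc : ∀ B ∈ (range n).powerset.filter (fun B => B.Nonempty), c B ∈ invS F n (GLset F n)) :
    c₀ ⊗ₜ[F] 1 + ∑ B ∈ (range n).powerset.filter (fun B => B.Nonempty), (c B ⊗ₜ[F] 1) *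
      (MuiM F (Fintype.card F) n n B * ((Lm F n n ^ (Fintype.card F - 2)) ⊗ₜ[F] 1)) ∈
      invSL F n (GLset F n) := by
  intro g hg
  apply linSub_mooreMat_injective
  rw [← coeffMap_linSub_mooreMat, linSub_sum_muiM]
  refine (tBasis F n (SV F n)).ext_elem fun B => ?_
  rw [repr_coeffMap, (tBasis F n (SV F n)).repr_sum_self]
  split_ifs with hB
  · have hmem : c (B.map Fin.valEmbedding) ∈ invS F n (GLset F n) := by
      apply hc
      rw [powerset_range_filter_nonempty]
      exact mem_map_of_mem (mapEmbedding Fin.valEmbedding).toEmbedding (by simpa using hB)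
    rw [map_smul, map_mul, Lm_pow_mem_invS g hg, hmem g hg]
  · exact h₀ g hg

theorem exists_eq_sum_muiM {f : SL F n} (hf : f ∈ invSL F n (GLset F n)) :
    ∃ c₀ : SV F n, ∃ c : Finset ℕ → SV F n, c₀ ∈ invS F n (GLset F n) ∧
      (∀ B, c B ∈ invS F n (GLset F n)) ∧
      f = c₀ ⊗ₜ[F] 1 + ∑ B ∈ (range n).powerset.filter (fun B => B.Nonempty), (c B ⊗ₜ[F] 1) *
        (MuiM F (Fintype.card F) n n B * ((Lm F n n ^ (Fintype.card F - 2)) ⊗ₜ[F] 1)) := by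
  have h (B : Finset (Fin n)) : ∃ d ∈ invS F n (GLset F n), B.Nonempty →
      (tBasis F n (SV F n)).repr (linSub (mooreMat F (Fintype.card F) n) f) B =
        Lm F n n ^ (Fintype.card F - 1) * d := by
    by_cases hB : B.Nonempty
    · obtain ⟨d, hd, h⟩ := exists_repr_linSub_eq hf hB
      exact ⟨d, hd, fun _ => h⟩
    · exact ⟨0, zero_mem _, fun h => absurd h hB⟩
  choose d hd hdB using h
  refine ⟨_, fun B => shuffleSign F B • d (univ.filter fun i => (i : ℕ) ∈ B),
    repr_linSub_mem_invS hf ∅, fun B => Subalgebra.smul_mem _ (hd _) _, ?_⟩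
  apply linSub_mooreMat_injective
  rw [linSub_sum_muiM]
  refine (tBasis F n (SV F n)).ext_elem fun B => ?_
  rw [(tBasis F n (SV F n)).repr_sum_self]
  split_ifs with hB
  · have h1 : (univ.filter fun i : Fin n => (i : ℕ) ∈ B.map Fin.valEmbedding) = B := by
      ext i
      simpa using mem_map' Fin.valEmbedding (a := i) (s := B)
    rw [h1, mul_smul_comm, smul_smul, shuffleSign_mul_self, one_smul, hdB B hB]
  · rw [not_nonempty_iff_eq_empty.1 hB]

theorem eq_zero_of_sum_muiM_eq_zero {c₀ : SV F n} {c : Finset ℕ → SV F n}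
    (h : c₀ ⊗ₜ[F] 1 + ∑ B ∈ (range n).powerset.filter (fun B => B.Nonempty), (c B ⊗ₜ[F] 1) *
      (MuiM F (Fintype.card F) n n B * ((Lm F n n ^ (Fintype.card F - 2)) ⊗ₜ[F] 1)) = 0) :
    c₀ = 0 ∧ ∀ B ∈ (range n).powerset.filter (fun B => B.Nonempty), c B = 0 := by
  have h1 := congrArg (linSub (mooreMat F (Fintype.card F) n)) h
  rw [linSub_sum_muiM, map_zero] at h1
  have h2 (B : Finset (Fin n)) := congrArg (fun x => (tBasis F n (SV F n)).repr x B) h1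
  simp only [(tBasis F n (SV F n)).repr_sum_self, map_zero, Finsupp.zero_apply] at h2
  refine ⟨by simpa using h2 ∅, fun B hB => ?_⟩
  rw [powerset_range_filter_nonempty, mem_map] at hB
  obtain ⟨S, hS, rfl⟩ := hB
  have h3 := h2 S
  rw [if_pos (mem_filter.1 hS).2, smul_eq_zero, mul_eq_zero] at h3
  have hsign : shuffleSign F (S.map Fin.valEmbedding) ≠ 0 :=
    left_ne_zero_of_mul (by rw [shuffleSign_mul_self]; exact one_ne_zero)
  exact (h3.resolve_left hsign).resolve_left (pow_ne_zero _ Lm_ne_zero)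

end Mui

/-- **Mui's theorem for `GL_n(q)`** (Theorem 2.5, second part). With
`R' = F_q[Q_{n,0}, Q_{n,1}, …, Q_{n,n−1}]`, the invariants
`(S(V) ⊗ Λ(V))^{GL_n(q)}` form a free `R'`-module with basis `1` together with
the elements `M_{n;b_1,…,b_j} L_n^{q−2}`, `1 ≤ j ≤ n`,
`0 ≤ b_1 < ⋯ < b_j ≤ n−1`; in particular
`S(V)^{GL_n(q)} = F_q[Q_{n,0}, …, Q_{n,n−1}]`. -/
theorem mui_GL_invariants
    (F : Type) [Field F] [Fintype F] (p r q n : ℕ)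
    (hp : p.Prime) (hr : 0 < r) (hq : q = p ^ r) (hF : Fintype.card F = q)
    (Q : (m : ℕ) → ℕ → SV F m) (hQ : DicksonProp F q Q) :
    let R' : Subalgebra F (SV F n) :=
      Algebra.adjoin F ((fun k => Q n k) '' Set.Iio n)
    let idx : Finset (Finset ℕ) := (range n).powerset.filter (fun B => B.Nonempty)
    (invS F n (GLset F n) = R')
    ∧ (∀ f : SL F n, f ∈ invSL F n (GLset F n) ↔
        ∃ c₀ : SV F n, ∃ c : Finset ℕ → SV F n,
          c₀ ∈ R' ∧ (∀ B ∈ idx, c B ∈ R') ∧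
          f = c₀ ⊗ₜ[F] 1 + ∑ B ∈ idx, (c B ⊗ₜ[F] 1) *
            (MuiM F q n n B * ((Lm F n n ^ (q - 2)) ⊗ₜ[F] 1)))
    ∧ (∀ c₀ : SV F n, ∀ c : Finset ℕ → SV F n,
        c₀ ∈ R' → (∀ B ∈ idx, c B ∈ R') →
        c₀ ⊗ₜ[F] 1 + ∑ B ∈ idx, (c B ⊗ₜ[F] 1) *
          (MuiM F q n n B * ((Lm F n n ^ (q - 2)) ⊗ₜ[F] 1)) = 0 →
        c₀ = 0 ∧ ∀ B ∈ idx, c B = 0) := by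
  subst hF
  have hR : Algebra.adjoin F ((fun k => Q n k) '' Set.Iio n) = invS F n (GLset F n) := by
    rw [invS_GLset hQ, dicksonAlg]
    congr 1
    ext x
    constructor
    · rintro ⟨k, hk, rfl⟩; exact ⟨⟨k, hk⟩, rfl⟩
    · rintro ⟨k, rfl⟩; exact ⟨k, k.2, rfl⟩
  intro R' idx
  have hR' : R' = invS F n (GLset F n) := hR
  rw [hR']
  refine ⟨rfl, fun f => ⟨fun hf => ?_, ?_⟩, fun c₀ c _ _ h => eq_zero_of_sum_muiM_eq_zero h⟩
  · obtain ⟨c₀, c, h₀, hc, h⟩ := exists_eq_sum_muiM hf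
    exact ⟨c₀, c, h₀, fun B _ => hc B, h⟩
  · rintro ⟨c₀, c, h₀, hc, rfl⟩
    exact mem_invSL_of_eq_sum_muiM h₀ hc
end
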